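/- (Global linear convergence of gradient descent.) Let K⁰ ∈ 𝕂 and set α = C(K⁰). For any step size 0 < η ≤ 1/L(α), the gradient-descent iterates defined by K^{n+1} = K^n − η∇C(K^n) satisfy K^n ∈ 𝕂 for every n ≥ 0 and C(K^n) − C(K*) ≤ (1 − 2μ²Λ_min(R)η/‖𝐗^{K*}‖_max)^n · (C(K⁰) − C(K*)). -/

import Mathlib

open Matrix Filter
open scoped Kronecker Topology

namespace MJLS

noncomputable section

attribute [local instance] Classical.propDecidable

/-- Closed-loop matrices `Γ i = A i - B i * K i`. -/
def Gam {d k N : ℕ} (A : Fin N → Matrix (Fin d) (Fin d) ℝ)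
    (B : Fin N → Matrix (Fin d) (Fin k) ℝ)
    (K : Fin N → Matrix (Fin k) (Fin d) ℝ) : Fin N → Matrix (Fin d) (Fin d) ℝ :=
  fun i => A i - B i * K i

/-- The operator `E_i(V) = ∑ j, p i j • V j`. -/
def opE {d N : ℕ} (Pr : Matrix (Fin N) (Fin N) ℝ)
    (V : Fin N → Matrix (Fin d) (Fin d) ℝ) : Fin N → Matrix (Fin d) (Fin d) ℝ :=
  fun i => ∑ j, Pr i j • V j

/-- The matrix `𝒜 = diag(Γᵀ ⊗ Γᵀ) (P ⊗ I)`. -/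
def calA {d N : ℕ} (Pr : Matrix (Fin N) (Fin N) ℝ)
    (Γ : Fin N → Matrix (Fin d) (Fin d) ℝ) :
    Matrix (Fin N × Fin d × Fin d) (Fin N × Fin d × Fin d) ℝ :=
  (Matrix.reindex (Equiv.prodComm (Fin d × Fin d) (Fin N))
      (Equiv.prodComm (Fin d × Fin d) (Fin N))
      (Matrix.blockDiagonal fun i => (Γ i)ᵀ ⊗ₖ (Γ i)ᵀ)) *
    (Pr ⊗ₖ (1 : Matrix (Fin d × Fin d) (Fin d × Fin d) ℝ))

/-- `K` is mean-square stabilizing: the spectral radius of `𝒜` is less than `1`. -/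
def MSS {d k N : ℕ} (Pr : Matrix (Fin N) (Fin N) ℝ)
    (A : Fin N → Matrix (Fin d) (Fin d) ℝ) (B : Fin N → Matrix (Fin d) (Fin k) ℝ)
    (K : Fin N → Matrix (Fin k) (Fin d) ℝ) : Prop :=
  spectralRadius ℂ ((calA Pr (Gam A B K)).map (algebraMap ℝ ℂ)) < 1

/-- `P` solves the coupled Lyapunov equations for the policy `K`. -/
def IsLyap {d k N : ℕ} (Pr : Matrix (Fin N) (Fin N) ℝ)
    (A : Fin N → Matrix (Fin d) (Fin d) ℝ) (B : Fin N → Matrix (Fin d) (Fin k) ℝ)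
    (Q : Fin N → Matrix (Fin d) (Fin d) ℝ) (R : Fin N → Matrix (Fin k) (Fin k) ℝ)
    (K : Fin N → Matrix (Fin k) (Fin d) ℝ)
    (P : Fin N → Matrix (Fin d) (Fin d) ℝ) : Prop :=
  ∀ i, P i = Q i + (K i)ᵀ * R i * K i + (Gam A B K i)ᵀ * opE Pr P i * Gam A B K i

/-- `P^K`, the (for mean-square stabilizing `K`, unique) solution of the coupled
Lyapunov equations. -/
def PK {d k N : ℕ} (Pr : Matrix (Fin N) (Fin N) ℝ)
    (A : Fin N → Matrix (Fin d) (Fin d) ℝ) (B : Fin N → Matrix (Fin d) (Fin k) ℝ)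
    (Q : Fin N → Matrix (Fin d) (Fin d) ℝ) (R : Fin N → Matrix (Fin k) (Fin k) ℝ)
    (K : Fin N → Matrix (Fin k) (Fin d) ℝ) : Fin N → Matrix (Fin d) (Fin d) ℝ :=
  if h : ∃ P, IsLyap Pr A B Q R K P then h.choose else 0

/-- The LQR cost `C(K) = ∑ i, π i * tr(P^K_i Sg)`. -/
def cost {d k N : ℕ} (Pr : Matrix (Fin N) (Fin N) ℝ)
    (A : Fin N → Matrix (Fin d) (Fin d) ℝ) (B : Fin N → Matrix (Fin d) (Fin k) ℝ)
    (Q : Fin N → Matrix (Fin d) (Fin d) ℝ) (R : Fin N → Matrix (Fin k) (Fin k) ℝ)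
    (piv : Fin N → ℝ) (Sg : Matrix (Fin d) (Fin d) ℝ)
    (K : Fin N → Matrix (Fin k) (Fin d) ℝ) : ℝ :=
  ∑ i, piv i * (PK Pr A B Q R K i * Sg).trace

/-- The operator `T_j(V) = ∑ i, p i j • (Γ i * V i * Γ iᵀ)`. -/
def opT {d N : ℕ} (Pr : Matrix (Fin N) (Fin N) ℝ)
    (Γ : Fin N → Matrix (Fin d) (Fin d) ℝ)
    (V : Fin N → Matrix (Fin d) (Fin d) ℝ) : Fin N → Matrix (Fin d) (Fin d) ℝ :=
  fun j => ∑ i, Pr i j • (Γ i * V i * (Γ i)ᵀ)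

/-- `𝐗^K = ∑_{t=0}^∞ T^t(X(0))` with `X_i(0) = π i • Sg`. -/
def XK {d N : ℕ} (Pr : Matrix (Fin N) (Fin N) ℝ) (piv : Fin N → ℝ)
    (Sg : Matrix (Fin d) (Fin d) ℝ) (Γ : Fin N → Matrix (Fin d) (Fin d) ℝ) :
    Fin N → Matrix (Fin d) (Fin d) ℝ :=
  ∑' t : ℕ, (opT Pr Γ)^[t] (fun i => piv i • Sg)

/-- `L^K_i = (R i + B iᵀ E_i(P^K) B i) K i - B iᵀ E_i(P^K) A i`. -/
def LK {d k N : ℕ} (Pr : Matrix (Fin N) (Fin N) ℝ)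
    (A : Fin N → Matrix (Fin d) (Fin d) ℝ) (B : Fin N → Matrix (Fin d) (Fin k) ℝ)
    (Q : Fin N → Matrix (Fin d) (Fin d) ℝ) (R : Fin N → Matrix (Fin k) (Fin k) ℝ)
    (K : Fin N → Matrix (Fin k) (Fin d) ℝ) : Fin N → Matrix (Fin k) (Fin d) ℝ :=
  fun i => (R i + (B i)ᵀ * opE Pr (PK Pr A B Q R K) i * B i) * K i
    - (B i)ᵀ * opE Pr (PK Pr A B Q R K) i * A i

/-- The operator `L_i(V) = Γ iᵀ E_i(V) Γ i`. -/
def opL {d N : ℕ} (Pr : Matrix (Fin N) (Fin N) ℝ)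
    (Γ : Fin N → Matrix (Fin d) (Fin d) ℝ)
    (V : Fin N → Matrix (Fin d) (Fin d) ℝ) : Fin N → Matrix (Fin d) (Fin d) ℝ :=
  fun i => (Γ i)ᵀ * opE Pr V i * Γ i

/-- `(P^K)'[E] = ∑_{t=0}^∞ L^t(Eᵀ L^K + (L^K)ᵀ E)`. -/
def PKd {d k N : ℕ} (Pr : Matrix (Fin N) (Fin N) ℝ)
    (Γ : Fin N → Matrix (Fin d) (Fin d) ℝ)
    (Lk E : Fin N → Matrix (Fin k) (Fin d) ℝ) : Fin N → Matrix (Fin d) (Fin d) ℝ :=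
  ∑' t : ℕ, (opL Pr Γ)^[t] (fun i => (E i)ᵀ * Lk i + (Lk i)ᵀ * E i)

/-- `‖V‖₂² = ∑ i, tr(V iᵀ V i)`. -/
def norm2sq {a b N : ℕ} (V : Fin N → Matrix (Fin a) (Fin b) ℝ) : ℝ :=
  ∑ i, ((V i)ᵀ * V i).trace

/-- The inner product `⟨V, S⟩ = ∑ i, tr(V iᵀ S i)`. -/
def ip {a b N : ℕ} (V S : Fin N → Matrix (Fin a) (Fin b) ℝ) : ℝ :=
  ∑ i, ((V i)ᵀ * S i).trace

/-- The spectral norm (maximal singular value) of a matrix. -/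
def specNorm {a b : ℕ} (M : Matrix (Fin a) (Fin b) ℝ) : ℝ :=
  ⨆ x : {x : EuclideanSpace ℝ (Fin b) // ‖x‖ ≤ 1}, ‖Matrix.toEuclideanLin M x.1‖

/-- The minimal singular value of a square matrix. -/
def sigmaMin {a : ℕ} (M : Matrix (Fin a) (Fin a) ℝ) : ℝ :=
  ⨅ x : {x : EuclideanSpace ℝ (Fin a) // ‖x‖ = 1}, ‖Matrix.toEuclideanLin M x.1‖

/-- `‖V‖_max = max_i ‖V i‖` (spectral norms). -/
def maxNorm {a b N : ℕ} (V : Fin N → Matrix (Fin a) (Fin b) ℝ) : ℝ :=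
  ⨆ i, specNorm (V i)

/-- `Λ_min(V) = min_i σ_min(V i)`. -/
def lamMin {a N : ℕ} (V : Fin N → Matrix (Fin a) (Fin a) ℝ) : ℝ :=
  ⨅ i, sigmaMin (V i)

/-- `μ = (min_i π i) · σ_min(Sg)`. -/
def mu {d N : ℕ} (piv : Fin N → ℝ) (Sg : Matrix (Fin d) (Fin d) ℝ) : ℝ :=
  (⨅ i, piv i) * sigmaMin Sg

/-- `ξ(α) = (1/Λ_min(Q))·((1 + ‖B‖²_max)·α/μ + ‖R‖_max) − 1`. -/
def xi {d k N : ℕ} (B : Fin N → Matrix (Fin d) (Fin k) ℝ)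
    (R : Fin N → Matrix (Fin k) (Fin k) ℝ) (Q : Fin N → Matrix (Fin d) (Fin d) ℝ)
    (piv : Fin N → ℝ) (Sg : Matrix (Fin d) (Fin d) ℝ) (α : ℝ) : ℝ :=
  (1 / lamMin Q) * ((1 + maxNorm B ^ 2) * α / mu piv Sg + maxNorm R) - 1

/-- The smoothness constant
`L(α) = 2·(‖R‖_max + ‖B‖²_max·(1 + 2ξ(α)/‖B‖_max)·α/μ)·α/Λ_min(Q)`. -/
def Lsm {d k N : ℕ} (B : Fin N → Matrix (Fin d) (Fin k) ℝ)
    (R : Fin N → Matrix (Fin k) (Fin k) ℝ) (Q : Fin N → Matrix (Fin d) (Fin d) ℝ)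
    (piv : Fin N → ℝ) (Sg : Matrix (Fin d) (Fin d) ℝ) (α : ℝ) : ℝ :=
  2 * (maxNorm R + maxNorm B ^ 2 * (1 + 2 * xi B R Q piv Sg α / maxNorm B)
      * α / mu piv Sg) * α / lamMin Q

end


section SpectralRadius
attribute [local instance] Matrix.linftyOpNormedRing Matrix.linftyOpNormedAlgebra

lemma linf_norm_le_iff {n : Type*} [Fintype n] [DecidableEq n] (M : Matrix n n ℝ) (r : ℝ) (hr : 0 ≤ r) :
    ‖M.map (algebraMap ℝ ℂ)‖ ≤ r ↔ ∀ i, ∑ j, |M i j| ≤ r := by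
  lift r to NNReal using hr
  rw [← coe_nnnorm, NNReal.coe_le_coe, Matrix.linfty_opNNNorm_def, Finset.sup_le_iff]
  simp only [Finset.mem_univ, true_imp_iff]
  refine forall_congr' fun i => ?_
  rw [← NNReal.coe_le_coe, NNReal.coe_sum]
  simp

lemma sr_bound {n : Type*} [Fintype n] [DecidableEq n] (M : Matrix n n ℝ)
    (h : spectralRadius ℂ (M.map (algebraMap ℝ ℂ)) < 1) :
    ∃ r : ℝ, 0 ≤ r ∧ r < 1 ∧ ∀ᶠ t : ℕ in atTop, ∀ i, ∑ j, |(M ^ t) i j| ≤ r ^ t := by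
  obtain ⟨r, hr1, hr2⟩ := exists_between h
  have hrtop : r ≠ ⊤ := ne_top_of_lt hr2
  lift r to NNReal using hrtop
  refine ⟨r, r.2, by exact_mod_cast hr2, ?_⟩
  have := spectrum.pow_nnnorm_pow_one_div_tendsto_nhds_spectralRadius (M.map (algebraMap ℝ ℂ))
  filter_upwards [this.eventually_lt_const hr1, eventually_gt_atTop 0] with t ht ht0
  have hpow : (M.map (algebraMap ℝ ℂ)) ^ t = (M ^ t).map (algebraMap ℝ ℂ) := by
    have := map_pow (RingHom.mapMatrix (algebraMap ℝ ℂ) : Matrix n n ℝ →+* Matrix n n ℂ) M t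
    exact this.symm
  rw [hpow] at ht
  rw [← linf_norm_le_iff _ _ (by positivity)]
  have h2 := ENNReal.rpow_le_rpow ht.le (z := (t:ℝ)) (by positivity)
  rw [← ENNReal.rpow_mul, one_div, inv_mul_cancel₀ (by positivity), ENNReal.rpow_one,
    ENNReal.rpow_natCast] at h2
  exact_mod_cast h2

lemma sr_of_row {n : Type*} [Fintype n] [DecidableEq n] [Nonempty n] (M : Matrix n n ℝ) (t : ℕ)
    (h : ∀ i, ∑ j, |(M ^ t) i j| < 1) :
    spectralRadius ℂ (M.map (algebraMap ℝ ℂ)) < 1 := by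
  have hpow : (M.map (algebraMap ℝ ℂ)) ^ t = (M ^ t).map (algebraMap ℝ ℂ) := by
    have := map_pow (RingHom.mapMatrix (algebraMap ℝ ℂ) : Matrix n n ℝ →+* Matrix n n ℂ) M t
    exact this.symm
  cases t with
  | zero =>
    obtain ⟨i⟩ := ‹Nonempty n›
    have := h i
    simp [Matrix.one_apply, apply_ite] at this
  | succ t =>
    have key : ‖(M.map (algebraMap ℝ ℂ)) ^ (t+1)‖ < 1 := by
      rw [hpow]
      obtain ⟨i0, hi0⟩ := Finite.exists_max (fun i => ∑ j, |(M ^ (t+1)) i j|)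
      exact lt_of_le_of_lt ((linf_norm_le_iff _ _ (Finset.sum_nonneg fun _ _ => abs_nonneg _)).2 hi0) (h i0)
    have h1 := spectrum.spectralRadius_le_pow_nnnorm_pow_one_div ℂ (M.map (algebraMap ℝ ℂ)) t
    have hone : ‖(1 : Matrix n n ℂ)‖₊ = 1 := by
      have : (1 : Matrix n n ℂ) = Matrix.diagonal (fun _ => 1) := by simp
      rw [this, Matrix.linfty_opNNNorm_diagonal]
      simp [Pi.nnnorm_def, Finset.sup_const]
    rw [hone] at h1
    simp only [ENNReal.coe_one, ENNReal.one_rpow, mul_one] at h1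
    refine lt_of_le_of_lt h1 ?_
    apply ENNReal.rpow_lt_one
    · exact_mod_cast key
    · positivity
end SpectralRadius

def stab {d N : ℕ} (Pr : Matrix (Fin N) (Fin N) ℝ) (Γ : Fin N → Matrix (Fin d) (Fin d) ℝ) : Prop :=
  spectralRadius ℂ ((calA Pr Γ).map (algebraMap ℝ ℂ)) < 1

lemma MSS_iff {d k N : ℕ} (Pr : Matrix (Fin N) (Fin N) ℝ)
    (A : Fin N → Matrix (Fin d) (Fin d) ℝ) (B : Fin N → Matrix (Fin d) (Fin k) ℝ)
    (K : Fin N → Matrix (Fin k) (Fin d) ℝ) : MSS Pr A B K ↔ stab Pr (Gam A B K) := by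
  unfold MSS stab
  convert Iff.rfl

def vecT {d N : ℕ} (V : Fin N → Matrix (Fin d) (Fin d) ℝ) : Fin N × Fin d × Fin d → ℝ :=
  fun p => V p.1 p.2.1 p.2.2

lemma calA_apply {d N : ℕ} (Pr : Matrix (Fin N) (Fin N) ℝ) (Γ : Fin N → Matrix (Fin d) (Fin d) ℝ)
    (i j : Fin N) (a b c e : Fin d) :
    calA Pr Γ (i, a, b) (j, c, e) = Pr i j * (Γ i c a * Γ i e b) := by
  unfold calA
  rw [Matrix.mul_apply, Fintype.sum_prod_type, Finset.sum_eq_single i, Fintype.sum_prod_type,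
    Finset.sum_eq_single c, Finset.sum_eq_single e]
  · simp [Matrix.blockDiagonal_apply, Matrix.kroneckerMap_apply]; ring
  · intro x _ hx; simp [Matrix.kroneckerMap_apply, hx]
  · simp
  · intro x _ hx; simp [Matrix.kroneckerMap_apply, hx]
  · simp
  · intro x _ hx; 
    apply Finset.sum_eq_zero
    intro y _
    simp [Matrix.blockDiagonal_apply, Ne.symm hx]
  · simp

lemma calA_mulVec {d N : ℕ} (Pr : Matrix (Fin N) (Fin N) ℝ) (Γ : Fin N → Matrix (Fin d) (Fin d) ℝ)
    (V : Fin N → Matrix (Fin d) (Fin d) ℝ) : calA Pr Γ *ᵥ vecT V = vecT (opL Pr Γ V) := by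
  funext ⟨i, a, b⟩
  simp only [Matrix.mulVec, dotProduct, Fintype.sum_prod_type, calA_apply, vecT, opL, opE,
    Matrix.mul_apply, Matrix.transpose_apply, Matrix.sum_apply, Matrix.smul_apply, smul_eq_mul,
    Finset.mul_sum, Finset.sum_mul]
  rw [Finset.sum_congr rfl fun j _ => Finset.sum_comm, Finset.sum_comm]
  refine Finset.sum_congr rfl fun x _ => Finset.sum_congr rfl fun y _ => Finset.sum_congr rfl fun z _ => ?_
  ring

lemma calA_transpose_mulVec {d N : ℕ} (Pr : Matrix (Fin N) (Fin N) ℝ) (Γ : Fin N → Matrix (Fin d) (Fin d) ℝ)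
    (V : Fin N → Matrix (Fin d) (Fin d) ℝ) : (calA Pr Γ)ᵀ *ᵥ vecT V = vecT (opT Pr Γ V) := by
  funext ⟨i, a, b⟩
  simp only [Matrix.mulVec, dotProduct, Fintype.sum_prod_type, calA_apply, vecT, opT, 
    Matrix.mul_apply, Matrix.transpose_apply, Matrix.sum_apply, Matrix.smul_apply, smul_eq_mul,
    Finset.mul_sum, Finset.sum_mul]
  refine Finset.sum_congr rfl fun x _ => ?_
  rw [Finset.sum_comm]
  refine Finset.sum_congr rfl fun y _ => Finset.sum_congr rfl fun z _ => ?_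
  ring

lemma calA_pow_mulVec {d N : ℕ} (Pr : Matrix (Fin N) (Fin N) ℝ) (Γ : Fin N → Matrix (Fin d) (Fin d) ℝ)
    (V : Fin N → Matrix (Fin d) (Fin d) ℝ) (t : ℕ) :
    (calA Pr Γ ^ t) *ᵥ vecT V = vecT ((opL Pr Γ)^[t] V) := by
  induction t with
  | zero => simp
  | succ t ih =>
    rw [pow_succ', ← Matrix.mulVec_mulVec, ih, calA_mulVec, Function.iterate_succ_apply']

lemma calA_transpose_pow_mulVec {d N : ℕ} (Pr : Matrix (Fin N) (Fin N) ℝ) (Γ : Fin N → Matrix (Fin d) (Fin d) ℝ)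
    (V : Fin N → Matrix (Fin d) (Fin d) ℝ) (t : ℕ) :
    (calA Pr Γ ^ t)ᵀ *ᵥ vecT V = vecT ((opT Pr Γ)^[t] V) := by
  rw [Matrix.transpose_pow]
  induction t with
  | zero => simp
  | succ t ih =>
    rw [pow_succ', ← Matrix.mulVec_mulVec, ih, calA_transpose_mulVec, Function.iterate_succ_apply']

/-- iterates of `opL` tend to zero. -/
lemma stab.tendsto {d N : ℕ} {Pr : Matrix (Fin N) (Fin N) ℝ} {Γ : Fin N → Matrix (Fin d) (Fin d) ℝ}
    (h : stab Pr Γ) (V : Fin N → Matrix (Fin d) (Fin d) ℝ) :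
    Tendsto (fun t => (opL Pr Γ)^[t] V) atTop (𝓝 0) := by
  obtain ⟨r, hr0, hr1, hr⟩ := sr_bound _ h
  rw [tendsto_pi_nhds]; intro i
  refine tendsto_pi_nhds.2 fun a => tendsto_pi_nhds.2 fun b => ?_
  show Tendsto (fun t => (opL Pr Γ)^[t] V i a b) atTop (𝓝 0)
  apply squeeze_zero_norm' (a := fun t => r ^ t * ∑ q, |vecT V q|)
  · filter_upwards [hr] with t ht
    have h1 : (opL Pr Γ)^[t] V i a b = ((calA Pr Γ ^ t) *ᵥ vecT V) (i, a, b) := by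
      rw [calA_pow_mulVec]; rfl
    rw [h1, Real.norm_eq_abs]
    calc _ ≤ ∑ q, |(calA Pr Γ ^ t) (i,a,b) q * vecT V q| := Finset.abs_sum_le_sum_abs _ _
      _ ≤ ∑ q, |(calA Pr Γ ^ t) (i,a,b) q| * ∑ q, |vecT V q| := by
        refine Finset.sum_le_sum fun q _ => ?_
        rw [abs_mul]
        gcongr
        exact Finset.single_le_sum (f := fun q => |vecT V q|) (fun _ _ => abs_nonneg _) (Finset.mem_univ q)
      _ ≤ _ := by
        rw [← Finset.sum_mul]
        gcongr
        exact ht _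
  · have := (tendsto_pow_atTop_nhds_zero_of_lt_one hr0 hr1).mul_const (∑ q, |vecT V q|)
    simpa using this

lemma stab.summable {d N : ℕ} {Pr : Matrix (Fin N) (Fin N) ℝ} {Γ : Fin N → Matrix (Fin d) (Fin d) ℝ}
    (h : stab Pr Γ) (V : Fin N → Matrix (Fin d) (Fin d) ℝ) :
    Summable (fun t => (opT Pr Γ)^[t] V) := by
  obtain ⟨r, hr0, hr1, hr⟩ := sr_bound _ h
  rw [Pi.summable]; intro i
  refine Pi.summable.2 fun a => Pi.summable.2 fun b => ?_
  show Summable (fun t => (opT Pr Γ)^[t] V i a b)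
  apply Summable.of_norm_bounded_eventually_nat (g := fun t => r ^ t * ∑ q, |vecT V q|)
  · exact (summable_geometric_of_lt_one hr0 hr1).mul_right _
  · filter_upwards [hr] with t ht
    have h1 : (opT Pr Γ)^[t] V i a b = ((calA Pr Γ ^ t)ᵀ *ᵥ vecT V) (i, a, b) := by
      rw [calA_transpose_pow_mulVec]; rfl
    rw [h1, Real.norm_eq_abs, Finset.mul_sum]
    refine (Finset.abs_sum_le_sum_abs _ _).trans ?_
    refine Finset.sum_le_sum fun q _ => ?_
    rw [abs_mul]
    refine mul_le_mul_of_nonneg_right ?_ (abs_nonneg _)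
    show |(calA Pr Γ ^ t) q (i, a, b)| ≤ _
    refine le_trans ?_ (ht q)
    exact Finset.single_le_sum (f := fun s => |(calA Pr Γ ^ t) q s|) (fun _ _ => abs_nonneg _) (Finset.mem_univ _)


/-- bilinear form of a matrix -/
def bf {m n : ℕ} (M : Matrix (Fin m) (Fin n) ℝ) (x : Fin m → ℝ) (y : Fin n → ℝ) : ℝ := x ⬝ᵥ (M *ᵥ y)

section bf
variable {m n l : ℕ}

lemma bf_add (M M' : Matrix (Fin m) (Fin n) ℝ) (x y) : bf (M + M') x y = bf M x y + bf M' x y := by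
  simp [bf, Matrix.add_mulVec, dotProduct_add]
lemma bf_sub (M M' : Matrix (Fin m) (Fin n) ℝ) (x y) : bf (M - M') x y = bf M x y - bf M' x y := by
  simp [bf, Matrix.sub_mulVec, dotProduct_sub]
lemma bf_neg (M : Matrix (Fin m) (Fin n) ℝ) (x y) : bf (-M) x y = - bf M x y := by
  simp [bf, Matrix.neg_mulVec]
lemma bf_smul (c : ℝ) (M : Matrix (Fin m) (Fin n) ℝ) (x y) : bf (c • M) x y = c * bf M x y := by
  simp [bf, Matrix.smul_mulVec]
lemma bf_zero (x y) : bf (0 : Matrix (Fin m) (Fin n) ℝ) x y = 0 := by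
  simp [bf]
lemma bf_sum {ι : Type*} (s : Finset ι) (M : ι → Matrix (Fin m) (Fin n) ℝ) (x y) :
    bf (∑ i ∈ s, M i) x y = ∑ i ∈ s, bf (M i) x y := by
  simp [bf, Matrix.sum_mulVec, dotProduct_sum]
lemma bf_one (x y : Fin m → ℝ) : bf 1 x y = x ⬝ᵥ y := by simp [bf]
lemma bf_mul (M : Matrix (Fin m) (Fin n) ℝ) (A : Matrix (Fin n) (Fin l) ℝ) (x y) :
    bf (M * A) x y = bf M x (A *ᵥ y) := by simp [bf]
lemma bf_tmul (M : Matrix (Fin m) (Fin n) ℝ) (A : Matrix (Fin m) (Fin l) ℝ) (x y) :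
    bf (Aᵀ * M) x y = bf M (A *ᵥ x) y := by
  simp only [bf, ← Matrix.mulVec_mulVec]
  rw [Matrix.dotProduct_mulVec, Matrix.vecMul_transpose]
lemma bf_t (A : Matrix (Fin m) (Fin l) ℝ) (x y) : bf Aᵀ x y = (A *ᵥ x) ⬝ᵥ y := by
  simp only [bf]
  rw [Matrix.dotProduct_mulVec, Matrix.vecMul_transpose]
lemma bf_t' (A : Matrix (Fin m) (Fin l) ℝ) (x y) : bf Aᵀ x y = bf A y x := by
  rw [bf_t, dotProduct_comm, bf]
lemma bf_add_left (M : Matrix (Fin m) (Fin n) ℝ) (x x' y) : bf M (x + x') y = bf M x y + bf M x' y := by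
  simp [bf]
lemma bf_add_right (M : Matrix (Fin m) (Fin n) ℝ) (x y y') : bf M x (y + y') = bf M x y + bf M x y' := by
  simp [bf, Matrix.mulVec_add]
lemma bf_sub_left (M : Matrix (Fin m) (Fin n) ℝ) (x x' y) : bf M (x - x') y = bf M x y - bf M x' y := by
  simp [bf]
lemma bf_sub_right (M : Matrix (Fin m) (Fin n) ℝ) (x y y') : bf M x (y - y') = bf M x y - bf M x y' := by
  simp [bf, Matrix.mulVec_sub]
lemma bf_smul_left (c : ℝ) (M : Matrix (Fin m) (Fin n) ℝ) (x y) : bf M (c • x) y = c * bf M x y := by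
  simp [bf]
lemma bf_smul_right (c : ℝ) (M : Matrix (Fin m) (Fin n) ℝ) (x y) : bf M x (c • y) = c * bf M x y := by
  simp [bf, Matrix.mulVec_smul]

/-- polarization bound -/
lemma bf_polar (W U : Matrix (Fin m) (Fin m) ℝ) (h1 : ∀ x, bf W x x ≤ bf U x x)
    (h2 : ∀ x, - bf U x x ≤ bf W x x) (a b : Fin m → ℝ) (β : ℝ) (hβ : 0 < β) :
    |bf W a b + bf W b a| ≤ β * bf U a a + β⁻¹ * bf U b b := by
  set s := Real.sqrt β with hs
  have hs0 : 0 < s := Real.sqrt_pos.2 hβ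
  have hβs : β = s * s := (Real.mul_self_sqrt hβ.le).symm
  have e1 := h1 (s • a + s⁻¹ • b)
  have e2 := h2 (s • a + s⁻¹ • b)
  have e3 := h1 (s • a - s⁻¹ • b)
  have e4 := h2 (s • a - s⁻¹ • b)
  simp only [bf_add_left, bf_add_right, bf_sub_left, bf_sub_right, bf_smul_left, bf_smul_right] at e1 e2 e3 e4
  have hss : s * s⁻¹ = 1 := mul_inv_cancel₀ hs0.ne'
  have c1 : ∀ t, s * (s⁻¹ * t) = t := fun t => by rw [← mul_assoc, hss, one_mul]
  have c2 : ∀ t, s⁻¹ * (s * t) = t := fun t => by rw [← mul_assoc, mul_comm s⁻¹, hss, one_mul]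
  have c3 : ∀ t, s * (s * t) = β * t := fun t => by rw [← mul_assoc, hβs]
  have c4 : ∀ t, s⁻¹ * (s⁻¹ * t) = β⁻¹ * t := fun t => by rw [← mul_assoc, hβs, mul_inv]
  simp only [mul_add, mul_sub, c1, c2, c3, c4] at e1 e2 e3 e4
  rw [abs_le]
  constructor <;> linarith

lemma dot_self_nonneg (x : Fin m → ℝ) : 0 ≤ x ⬝ᵥ x :=
  Finset.sum_nonneg fun i _ => mul_self_nonneg (x i)

lemma dot_cs (x y : Fin m → ℝ) : (x ⬝ᵥ y) ^ 2 ≤ (x ⬝ᵥ x) * (y ⬝ᵥ y) := by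
  have := Finset.sum_mul_sq_le_sq_mul_sq Finset.univ x y
  simpa [dotProduct, pow_two] using this

lemma norm_toE (M : Matrix (Fin m) (Fin n) ℝ) (x : EuclideanSpace ℝ (Fin n)) :
    ‖Matrix.toEuclideanLin M x‖ ^ 2 = (M *ᵥ x.ofLp) ⬝ᵥ (M *ᵥ x.ofLp) := by
  rw [EuclideanSpace.norm_sq_eq]
  simp [dotProduct, pow_two, Matrix.toEuclideanLin]

lemma norm_E (x : EuclideanSpace ℝ (Fin n)) : ‖x‖ ^ 2 = x.ofLp ⬝ᵥ x.ofLp := by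
  rw [EuclideanSpace.norm_sq_eq]
  simp [dotProduct, pow_two]

lemma specNorm_bdd (M : Matrix (Fin m) (Fin n) ℝ) :
    BddAbove (Set.range fun x : {x : EuclideanSpace ℝ (Fin n) // ‖x‖ ≤ 1} => ‖Matrix.toEuclideanLin M x.1‖) := by
  refine ⟨‖(Matrix.toEuclideanLin M).toContinuousLinearMap‖, ?_⟩
  rintro _ ⟨x, rfl⟩
  have := (Matrix.toEuclideanLin M).toContinuousLinearMap.le_opNorm x.1
  refine this.trans ?_
  have := norm_nonneg (Matrix.toEuclideanLin M).toContinuousLinearMap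
  have h2 := x.2
  nlinarith

lemma specNorm_nonneg (M : Matrix (Fin m) (Fin n) ℝ) : 0 ≤ specNorm M :=
  Real.iSup_nonneg fun _ => norm_nonneg _

lemma specNorm_E (M : Matrix (Fin m) (Fin n) ℝ) (x : EuclideanSpace ℝ (Fin n)) :
    ‖Matrix.toEuclideanLin M x‖ ≤ specNorm M * ‖x‖ := by
  by_cases hx : x = 0
  · simp [hx]
  have hx' : 0 < ‖x‖ := norm_pos_iff.2 hx
  have := le_ciSup (specNorm_bdd M) ⟨‖x‖⁻¹ • x, by rw [norm_smul]; simp [hx'.ne']⟩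
  simp only [map_smul, norm_smul, norm_inv, norm_norm] at this
  rw [inv_mul_le_iff₀ hx'] at this
  rw [mul_comm]; exact this

lemma specNorm_dot (M : Matrix (Fin m) (Fin n) ℝ) (v : Fin n → ℝ) :
    (M *ᵥ v) ⬝ᵥ (M *ᵥ v) ≤ specNorm M ^ 2 * (v ⬝ᵥ v) := by
  have := specNorm_E M (WithLp.toLp 2 v)
  have h2 := pow_le_pow_left₀ (norm_nonneg _) this 2
  rw [norm_toE, mul_pow, norm_E] at h2
  exact h2

lemma specNorm_bf (M : Matrix (Fin m) (Fin m) ℝ) (v : Fin m → ℝ) :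
    bf M v v ≤ specNorm M * (v ⬝ᵥ v) := by
  have h1 := specNorm_dot M v
  have h2 := dot_cs v (M *ᵥ v)
  have h0 := dot_self_nonneg v
  have h3 := specNorm_nonneg M
  apply le_of_sq_le_sq₀ _ (by positivity)
  calc _ ≤ _ := h2
    _ ≤ (v ⬝ᵥ v) * (specNorm M ^ 2 * (v ⬝ᵥ v)) := by gcongr
    _ = _ := by ring
where le_of_sq_le_sq₀ {a b : ℝ} (h : a ^ 2 ≤ b ^ 2) (hb : 0 ≤ b) : a ≤ b := abs_le_of_sq_le_sq' h hb |>.2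

lemma sigmaMin_le {M : Matrix (Fin m) (Fin m) ℝ} (x : EuclideanSpace ℝ (Fin m)) (hx : ‖x‖ = 1) :
    sigmaMin M ≤ ‖Matrix.toEuclideanLin M x‖ :=
  ciInf_le (f := fun x : {x : EuclideanSpace ℝ (Fin m) // ‖x‖ = 1} => ‖Matrix.toEuclideanLin M x.1‖)
    ⟨0, by rintro _ ⟨x, rfl⟩; exact norm_nonneg _⟩ ⟨x, hx⟩

lemma sigmaMin_nonneg (M : Matrix (Fin m) (Fin m) ℝ) : 0 ≤ sigmaMin M :=
  Real.iInf_nonneg fun _ => norm_nonneg _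

lemma psd_sub_sigmaMin {M : Matrix (Fin m) (Fin m) ℝ} (hM : M.PosSemidef) :
    (M - sigmaMin M • (1 : Matrix (Fin m) (Fin m) ℝ)).PosSemidef := by
  have hH : (M - sigmaMin M • (1 : Matrix (Fin m) (Fin m) ℝ)).IsHermitian := by
    apply hM.1.sub
    simp [Matrix.IsHermitian]
  rw [hH.posSemidef_iff_eigenvalues_nonneg]
  intro i
  set e := hH.eigenvalues i with he
  set v := hH.eigenvectorBasis i with hv
  have hvn : ‖v‖ = 1 := hH.eigenvectorBasis.orthonormal.1 i
  have h1 : (M - sigmaMin M • (1 : Matrix (Fin m) (Fin m) ℝ)) *ᵥ v.ofLp = e • v.ofLp :=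
    hH.mulVec_eigenvectorBasis i
  have h2 : M *ᵥ v.ofLp = (e + sigmaMin M) • v.ofLp := by
    rw [Matrix.sub_mulVec, Matrix.smul_mulVec, Matrix.one_mulVec] at h1
    rw [add_smul, ← h1]; simp
  have hvd : v.ofLp ⬝ᵥ v.ofLp = 1 := by rw [← norm_E, hvn]; norm_num
  have h3 : 0 ≤ e + sigmaMin M := by
    have := hM.dotProduct_mulVec_nonneg v.ofLp
    rw [h2, dotProduct_smul] at this
    simp only [star_trivial, hvd, smul_eq_mul, mul_one] at this
    exact this
  have h4 := sigmaMin_le (M := M) v hvn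
  have h5 : ‖Matrix.toEuclideanLin M v‖ = e + sigmaMin M := by
    have h6 : ‖Matrix.toEuclideanLin M v‖ ^ 2 = (e + sigmaMin M) ^ 2 := by
      rw [norm_toE, h2, dotProduct_smul, smul_dotProduct, hvd]; simp [pow_two]
    exact (pow_left_inj₀ (norm_nonneg _) h3 two_ne_zero).1 h6
  show 0 ≤ e
  linarith

lemma psd_bf {M : Matrix (Fin m) (Fin m) ℝ} (hM : M.PosSemidef) (x) : 0 ≤ bf M x x := by
  simpa [bf] using hM.dotProduct_mulVec_nonneg x

lemma sigmaMin_bf {M : Matrix (Fin m) (Fin m) ℝ} (hM : M.PosSemidef) (x : Fin m → ℝ) :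
    sigmaMin M * (x ⬝ᵥ x) ≤ bf M x x := by
  have := psd_bf (psd_sub_sigmaMin hM) x
  rw [bf_sub, bf_smul, bf_one] at this
  linarith

lemma sigmaMin_pos (hm : 0 < m) {M : Matrix (Fin m) (Fin m) ℝ} (hM : M.PosDef) : 0 < sigmaMin M := by
  have : Nonempty (Fin m) := ⟨⟨0, hm⟩⟩
  have : Nontrivial (EuclideanSpace ℝ (Fin m)) := inferInstance
  have hc : IsCompact (Metric.sphere (0 : EuclideanSpace ℝ (Fin m)) 1) := isCompact_sphere _ _
  have hne : (Metric.sphere (0 : EuclideanSpace ℝ (Fin m)) 1).Nonempty :=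
    NormedSpace.sphere_nonempty.2 zero_le_one
  obtain ⟨x0, hx0, hmin⟩ := hc.exists_isMinOn hne
    (f := fun x => ‖Matrix.toEuclideanLin M x‖)
    ((Matrix.toEuclideanLin M).continuous_of_finiteDimensional.norm.continuousOn)
  have : Nonempty {x : EuclideanSpace ℝ (Fin m) // ‖x‖ = 1} := ⟨⟨x0, by simpa using hx0⟩⟩
  have hle : ‖Matrix.toEuclideanLin M x0‖ ≤ sigmaMin M :=
    le_ciInf fun x => hmin (by simp [x.2])
  refine lt_of_lt_of_le ?_ hle
  rw [norm_pos_iff]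
  intro h0
  have hx1 : ‖x0‖ = 1 := by simpa using hx0
  have hxne : x0.ofLp ≠ 0 := by
    intro h
    have : ‖x0‖ ^ 2 = 0 := by rw [norm_E, h]; simp
    rw [hx1] at this; norm_num at this
  have hp := hM.dotProduct_mulVec_pos hxne
  have hz : ‖Matrix.toEuclideanLin M x0‖ ^ 2 = 0 := by rw [h0]; simp
  rw [norm_toE] at hz
  have : M *ᵥ x0.ofLp = 0 := dotProduct_self_eq_zero.1 hz
  rw [this] at hp
  simp at hp

/-- trace against PSD matrix -/
lemma trace_mul_psd_nonneg {V S : Matrix (Fin m) (Fin m) ℝ} (hV : ∀ x, 0 ≤ bf V x x)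
    (hS : S.PosSemidef) : 0 ≤ (V * S).trace := by
  obtain ⟨l, w, hw⟩ := Matrix.posSemidef_iff_eq_sum_vecMulVec.1 hS
  rw [hw, Matrix.mul_sum, Matrix.trace_sum]
  refine Finset.sum_nonneg fun i _ => ?_
  rw [Matrix.mul_vecMulVec, Matrix.trace_vecMulVec, dotProduct_comm]
  simpa [bf] using hV (w i)

lemma trace_nn {V : Matrix (Fin m) (Fin m) ℝ} (hV : ∀ x, 0 ≤ bf V x x) : 0 ≤ V.trace := by
  have := trace_mul_psd_nonneg hV Matrix.PosSemidef.one
  simpa using this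

lemma trace_tmul_bf (L : Matrix (Fin n) (Fin m) ℝ) (V : Matrix (Fin m) (Fin m) ℝ) :
    (V * (Lᵀ * L)).trace = ∑ r, bf V (L r) (L r) := by
  rw [← Matrix.mul_assoc, Matrix.trace_mul_comm, Matrix.trace]
  refine Finset.sum_congr rfl fun r _ => ?_
  simp only [Matrix.diag_apply, bf]
  rw [Matrix.mul_apply, dotProduct]
  refine Finset.sum_congr rfl fun j _ => ?_
  congr 1

/-- `ΔᵀΔ ≤ tr(ΔᵀΔ) I` -/
lemma mulVec_dot_le (L : Matrix (Fin n) (Fin m) ℝ) (x : Fin m → ℝ) :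
    (L *ᵥ x) ⬝ᵥ (L *ᵥ x) ≤ (Lᵀ * L).trace * (x ⬝ᵥ x) := by
  have h := trace_tmul_bf L 1
  rw [one_mul] at h
  rw [h, Finset.sum_mul, dotProduct]
  refine Finset.sum_le_sum fun r _ => ?_
  rw [bf_one]
  have := dot_cs (L r) x
  rw [pow_two] at this
  exact this

lemma bf_le_trace {V : Matrix (Fin m) (Fin m) ℝ} (hV : V.PosSemidef) (x : Fin m → ℝ) :
    bf V x x ≤ V.trace * (x ⬝ᵥ x) := by
  obtain ⟨l, w, hw⟩ := Matrix.posSemidef_iff_eq_sum_vecMulVec.1 hV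
  rw [hw, Matrix.trace_sum, bf_sum, Finset.sum_mul]
  refine Finset.sum_le_sum fun i _ => ?_
  rw [Matrix.trace_vecMulVec]
  have := dot_cs (w i) x
  simp only [bf, Matrix.vecMulVec_mulVec, star_trivial, dotProduct_smul, MulOpposite.smul_eq_mul_unop]
  rw [pow_two] at this
  simp
  rw [dotProduct_comm x]; exact this

end bf

def nn {d N : ℕ} (V : Fin N → Matrix (Fin d) (Fin d) ℝ) : Prop := ∀ i x, 0 ≤ bf (V i) x x

section opLsec
variable {d N : ℕ} (Pr : Matrix (Fin N) (Fin N) ℝ) (Γ : Fin N → Matrix (Fin d) (Fin d) ℝ)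

lemma opE_add (V W : Fin N → Matrix (Fin d) (Fin d) ℝ) : opE Pr (V + W) = opE Pr V + opE Pr W := by
  funext i; simp [opE, Finset.sum_add_distrib]
lemma opE_smul (c : ℝ) (V : Fin N → Matrix (Fin d) (Fin d) ℝ) : opE Pr (c • V) = c • opE Pr V := by
  funext i; simp [opE, Finset.smul_sum, smul_comm c]

def opLlin : (Fin N → Matrix (Fin d) (Fin d) ℝ) →ₗ[ℝ] (Fin N → Matrix (Fin d) (Fin d) ℝ) where
  toFun := opL Pr Γ
  map_add' V W := by funext i; simp [opL, opE_add, Matrix.mul_add, Matrix.add_mul]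
  map_smul' c V := by funext i; simp [opL, opE_smul]

lemma opL_add (V W) : opL Pr Γ (V + W) = opL Pr Γ V + opL Pr Γ W := (opLlin Pr Γ).map_add V W
lemma opL_sub (V W) : opL Pr Γ (V - W) = opL Pr Γ V - opL Pr Γ W := (opLlin Pr Γ).map_sub V W
lemma opL_smul (c : ℝ) (V) : opL Pr Γ (c • V) = c • opL Pr Γ V := (opLlin Pr Γ).map_smul c V

lemma bf_opE (V : Fin N → Matrix (Fin d) (Fin d) ℝ) (i x y) :
    bf (opE Pr V i) x y = ∑ j, Pr i j * bf (V j) x y := by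
  simp [opE, bf_sum, bf_smul]

lemma bf_opL (V : Fin N → Matrix (Fin d) (Fin d) ℝ) (i x y) :
    bf (opL Pr Γ V i) x y = bf (opE Pr V i) (Γ i *ᵥ x) (Γ i *ᵥ y) := by
  rw [opL, bf_mul, bf_tmul]

variable {Pr Γ}

lemma opE_nn (hPr : ∀ i j, 0 ≤ Pr i j) {V : Fin N → Matrix (Fin d) (Fin d) ℝ} (hV : nn V) : nn (opE Pr V) := by
  intro i x
  rw [bf_opE]
  exact Finset.sum_nonneg fun j _ => mul_nonneg (hPr i j) (hV j _)

lemma opL_nn (hPr : ∀ i j, 0 ≤ Pr i j) {V : Fin N → Matrix (Fin d) (Fin d) ℝ} (hV : nn V) : nn (opL Pr Γ V) := by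
  intro i x
  rw [bf_opL]
  exact opE_nn hPr hV i _

lemma nn.add {V W : Fin N → Matrix (Fin d) (Fin d) ℝ} (hV : nn V) (hW : nn W) : nn (V + W) := by
  intro i x
  rw [Pi.add_apply, bf_add]
  exact add_nonneg (hV i x) (hW i x)

/-- fixed points with nonnegative source are nonnegative -/
lemma stab.nn_of_fix (hPr : ∀ i j, 0 ≤ Pr i j) (h : stab Pr Γ) {V Z : Fin N → Matrix (Fin d) (Fin d) ℝ}
    (hV : V = Z + opL Pr Γ V) (hZ : nn Z) : nn V := by
  have key : ∀ t : ℕ, nn (V - (opL Pr Γ)^[t] V) := by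
    intro t
    induction t with
    | zero => intro i x; simp [bf_zero]
    | succ t ih =>
      rw [Function.iterate_succ_apply']
      have : V - opL Pr Γ ((opL Pr Γ)^[t] V) = Z + opL Pr Γ (V - (opL Pr Γ)^[t] V) := by
        rw [opL_sub]
        nth_rewrite 1 [hV]
        abel
      rw [this]
      exact hZ.add (opL_nn hPr ih)
  intro i x
  have ht := h.tendsto V
  have hcont : Continuous fun W : Fin N → Matrix (Fin d) (Fin d) ℝ => bf ((V - W) i) x x := by
    simp only [bf, Pi.sub_apply]
    fun_prop
  have h2 := (hcont.tendsto 0).comp ht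
  simp only [sub_zero] at h2
  exact ge_of_tendsto' h2 fun t => key t i x

end opLsec

section Normed
attribute [local instance] Matrix.normedAddCommGroup Matrix.normedSpace
variable {d N : ℕ} (Pr : Matrix (Fin N) (Fin N) ℝ) (Γ : Fin N → Matrix (Fin d) (Fin d) ℝ)

/-- unbundled (curried) version of the tuple space, with its sup norm -/
abbrev Wsp (d N : ℕ) : Type := Fin N → Fin d → Fin d → ℝ

def eW {d N : ℕ} : (Fin N → Matrix (Fin d) (Fin d) ℝ) ≃ₗ[ℝ] Wsp d N where
  toFun V := fun i a b => V i a b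
  invFun V := fun i => Matrix.of (V i)
  map_add' _ _ := rfl
  map_smul' _ _ := rfl
  left_inv _ := rfl
  right_inv _ := rfl

noncomputable def Lc : Wsp d N →L[ℝ] Wsp d N :=
  LinearMap.toContinuousLinearMap (eW.toLinearMap ∘ₗ opLlin Pr Γ ∘ₗ eW.symm.toLinearMap)

lemma Lc_apply (V) : Lc Pr Γ V = eW (opL Pr Γ (eW.symm V)) := rfl

noncomputable def sol : (Fin N → Matrix (Fin d) (Fin d) ℝ) →ₗ[ℝ] (Fin N → Matrix (Fin d) (Fin d) ℝ) :=
  eW.symm.toLinearMap ∘ₗ (Ring.inverse (1 - Lc Pr Γ) : Wsp d N →L[ℝ] Wsp d N).toLinearMap ∘ₗ eW.toLinearMap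

lemma sol_apply (Z) : sol Pr Γ Z = eW.symm (Ring.inverse (1 - Lc Pr Γ) (eW Z)) := rfl

variable {Pr Γ}

lemma stab.isUnit (h : stab Pr Γ) : IsUnit (1 - Lc Pr Γ) := by
  have hinj : Function.Injective ((1 - Lc Pr Γ : Wsp d N →L[ℝ] Wsp d N) : Wsp d N →ₗ[ℝ] Wsp d N) := by
    rw [← LinearMap.ker_eq_bot, LinearMap.ker_eq_bot']
    intro V' hV
    obtain ⟨V, rfl⟩ := eW.surjective V'
    have hV : eW (V - opL Pr Γ V) = 0 := hV
    have hV : V - opL Pr Γ V = 0 := (LinearEquiv.map_eq_zero_iff _).1 hV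
    have hfix : opL Pr Γ V = V := (sub_eq_zero.1 hV).symm
    have ht := h.tendsto V
    have : ∀ t : ℕ, (opL Pr Γ)^[t] V = V := fun t => Function.iterate_fixed hfix t
    simp only [this] at ht
    rw [tendsto_nhds_unique tendsto_const_nhds ht, map_zero]
  rw [ContinuousLinearMap.isUnit_iff_bijective]
  exact ⟨hinj, LinearMap.surjective_of_injective hinj⟩

lemma sol_eq (h : IsUnit (1 - Lc Pr Γ)) (Z) : sol Pr Γ Z = Z + opL Pr Γ (sol Pr Γ Z) := by
  have := Ring.mul_inverse_cancel _ h
  have h2 := congrArg (fun f => f (eW Z)) this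
  have h3 : eW (sol Pr Γ Z - opL Pr Γ (sol Pr Γ Z)) = eW Z := h2
  have h3 := eW.injective h3
  rw [sub_eq_iff_eq_add] at h3
  exact h3

lemma sol_unique (h : IsUnit (1 - Lc Pr Γ)) {V Z} (hV : V = Z + opL Pr Γ V) : V = sol Pr Γ Z := by
  have := Ring.inverse_mul_cancel _ h
  have h2 := congrArg (fun f => f (eW V)) this
  have h3 : eW (sol Pr Γ (V - opL Pr Γ V)) = eW V := h2
  have h3 := eW.injective h3
  rw [← h3]
  congr 1
  rw [sub_eq_iff_eq_add]; exact hV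

lemma sol_nn (hPr : ∀ i j, 0 ≤ Pr i j) (h : stab Pr Γ) {Z} (hZ : nn Z) : nn (sol Pr Γ Z) :=
  h.nn_of_fix hPr (sol_eq h.isUnit Z) hZ

variable {k : ℕ} (Pr) (A : Fin N → Matrix (Fin d) (Fin d) ℝ) (B : Fin N → Matrix (Fin d) (Fin k) ℝ)
  (Q : Fin N → Matrix (Fin d) (Fin d) ℝ) (R : Fin N → Matrix (Fin k) (Fin k) ℝ)

def src (K : Fin N → Matrix (Fin k) (Fin d) ℝ) : Fin N → Matrix (Fin d) (Fin d) ℝ :=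
  fun i => Q i + (K i)ᵀ * R i * K i

lemma isLyap_iff (K P) : IsLyap Pr A B Q R K P ↔ P = src Q R K + opL Pr (Gam A B K) P := by
  rw [funext_iff]; rfl

lemma PK_eq_sol {K} (h : IsUnit (1 - Lc Pr (Gam A B K))) :
    PK Pr A B Q R K = sol Pr (Gam A B K) (src Q R K) := by
  have hex : ∃ P, IsLyap Pr A B Q R K P := ⟨_, (isLyap_iff Pr A B Q R K _).2 (sol_eq h _)⟩
  have : PK Pr A B Q R K = hex.choose := by
    unfold PK; rw [dif_pos hex]
  rw [this]
  exact sol_unique h ((isLyap_iff Pr A B Q R K _).1 hex.choose_spec)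

lemma PK_fix {K} (h : stab Pr (Gam A B K)) :
    PK Pr A B Q R K = src Q R K + opL Pr (Gam A B K) (PK Pr A B Q R K) := by
  rw [PK_eq_sol Pr A B Q R h.isUnit]
  exact sol_eq h.isUnit _

lemma contDiff_entries {E : Type*} [NormedAddCommGroup E] [NormedSpace ℝ E] {a b : ℕ}
    {f : E → Fin N → Matrix (Fin a) (Fin b) ℝ} (h : ∀ i r s, ContDiff ℝ 2 (fun x => f x i r s)) :
    ContDiff ℝ 2 f :=
  contDiff_pi.2 fun i => contDiff_pi.2 fun r => contDiff_pi.2 fun s => h i r s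

lemma contDiff_entry {a b : ℕ} (i : Fin N) (r : Fin a) (s : Fin b) :
    ContDiff ℝ 2 (fun K : Fin N → Matrix (Fin a) (Fin b) ℝ => K i r s) := by
  have h0 : ContDiff ℝ 2 (fun K : Fin N → Matrix (Fin a) (Fin b) ℝ => K) := contDiff_id
  exact contDiff_pi.1 (contDiff_pi.1 (contDiff_pi.1 h0 i) r) s

lemma contDiff_src : ContDiff ℝ 2 (src (d := d) Q R) := by
  apply contDiff_entries
  intro i r s
  simp only [src, Matrix.add_apply, Matrix.mul_apply, Matrix.transpose_apply]
  have := fun r s => contDiff_entry (N := N) (a := k) (b := d) i r s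
  refine contDiff_const.add (ContDiff.sum fun x _ => (ContDiff.sum fun y _ => ?_).mul (this _ _))
  exact (this _ _).mul contDiff_const

lemma contDiff_Gam_entry (i r s) : ContDiff ℝ 2 (fun K => Gam A B K i r s) := by
  simp only [Gam, Matrix.sub_apply, Matrix.mul_apply]
  exact contDiff_const.sub (ContDiff.sum fun y _ => contDiff_const.mul (contDiff_entry _ _ _))

lemma contDiff_Lc : ContDiff ℝ 2 (fun K => Lc Pr (Gam A B K)) := by
  rw [contDiff_clm_apply_iff]
  intro V
  simp only [Lc_apply]
  refine contDiff_pi.2 fun i => contDiff_pi.2 fun r => contDiff_pi.2 fun s => ?_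
  show ContDiff ℝ 2 (fun K => opL Pr (Gam A B K) (eW.symm V) i r s)
  simp only [opL, Matrix.mul_apply, Matrix.transpose_apply]
  have := contDiff_Gam_entry A B i
  refine ContDiff.sum fun x _ => (ContDiff.sum fun y _ => ?_).mul (this _ _)
  exact (this _ _).mul contDiff_const

lemma contDiffAt_PK {K} (h : stab Pr (Gam A B K)) : ContDiffAt ℝ 2 (PK Pr A B Q R) K := by
  have hL : ContDiff ℝ 2 (fun K => 1 - Lc Pr (Gam A B K)) := contDiff_const.sub (contDiff_Lc Pr A B)
  have hu := h.isUnit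
  have ev : ∀ᶠ K' in 𝓝 K, IsUnit (1 - Lc Pr (Gam A B K')) :=
    hL.continuous.continuousAt.eventually (Units.isOpen.mem_nhds hu)
  have hinv : ContDiffAt ℝ 2 (fun K => (Ring.inverse (1 - Lc Pr (Gam A B K)) : Wsp d N →L[ℝ] Wsp d N)) K := by
    obtain ⟨u, hu⟩ := hu
    have h1 := contDiffAt_ringInverse ℝ u (n := 2)
    rw [hu] at h1
    exact h1.comp K hL.contDiffAt
  have hs : ContDiff ℝ 2 (fun K => eW (src Q R K)) := by
    refine contDiff_pi.2 fun i => contDiff_pi.2 fun r => contDiff_pi.2 fun s => ?_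
    exact (contDiff_entry i r s).comp (contDiff_src Q R)
  have h2' : ContDiffAt ℝ 2 (fun K => (Ring.inverse (1 - Lc Pr (Gam A B K)) : Wsp d N →L[ℝ] Wsp d N) (eW (src Q R K))) K :=
    hinv.clm_apply hs.contDiffAt
  have h2 : ContDiffAt ℝ 2 (fun K => sol Pr (Gam A B K) (src Q R K)) K := by
    refine contDiffAt_pi.2 fun i => contDiffAt_pi.2 fun r => contDiffAt_pi.2 fun s => ?_
    exact contDiffAt_pi.1 (contDiffAt_pi.1 (contDiffAt_pi.1 h2' i) r) s
  refine h2.congr_of_eventuallyEq ?_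
  filter_upwards [ev] with K' hK'
  exact PK_eq_sol Pr A B Q R hK'

end Normed

/-- entrywise derivative of a matrix-valued curve -/
def mHD {m n : ℕ} (M : ℝ → Matrix (Fin m) (Fin n) ℝ) (M' : Matrix (Fin m) (Fin n) ℝ) (s : ℝ) : Prop :=
  ∀ a b, HasDerivAt (fun r => M r a b) (M' a b) s

section mHD
variable {m n l : ℕ} {s : ℝ}

lemma mHD.mul {M : ℝ → Matrix (Fin m) (Fin n) ℝ} {M'} {L : ℝ → Matrix (Fin n) (Fin l) ℝ} {L'}
    (h1 : mHD M M' s) (h2 : mHD L L' s) : mHD (fun r => M r * L r) (M' * L s + M s * L') s := by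
  intro a b
  simp only [Matrix.add_apply, Matrix.mul_apply, ← Finset.sum_add_distrib]
  exact HasDerivAt.fun_sum fun j _ => (h1 a j).mul (h2 j b)
lemma mHD.add {M : ℝ → Matrix (Fin m) (Fin n) ℝ} {M'} {L : ℝ → Matrix (Fin m) (Fin n) ℝ} {L'}
    (h1 : mHD M M' s) (h2 : mHD L L' s) : mHD (fun r => M r + L r) (M' + L') s :=
  fun a b => (h1 a b).add (h2 a b)
lemma mHD.sub {M : ℝ → Matrix (Fin m) (Fin n) ℝ} {M'} {L : ℝ → Matrix (Fin m) (Fin n) ℝ} {L'}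
    (h1 : mHD M M' s) (h2 : mHD L L' s) : mHD (fun r => M r - L r) (M' - L') s :=
  fun a b => (h1 a b).sub (h2 a b)
lemma mHD.tr {M : ℝ → Matrix (Fin m) (Fin n) ℝ} {M'}
    (h1 : mHD M M' s) : mHD (fun r => (M r)ᵀ) M'ᵀ s :=
  fun a b => h1 b a
lemma mHD.const (M : Matrix (Fin m) (Fin n) ℝ) : mHD (fun _ => M) 0 s :=
  fun a b => hasDerivAt_const s (M a b)
lemma mHD.line (K D : Matrix (Fin m) (Fin n) ℝ) : mHD (fun r => K + r • D) D s := by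
  intro a b
  have := ((hasDerivAt_id s).mul_const (D a b)).const_add (K a b)
  simpa using this
lemma mHD.opE {N d : ℕ} (Pr : Matrix (Fin N) (Fin N) ℝ) {p : ℝ → Fin N → Matrix (Fin d) (Fin d) ℝ} {p'}
    (h : ∀ i, mHD (fun r => p r i) (p' i) s) (i) : mHD (fun r => MJLS.opE Pr (p r) i) (MJLS.opE Pr p' i) s := by
  intro a b
  simp only [MJLS.opE, Matrix.sum_apply, Matrix.smul_apply, smul_eq_mul]
  exact HasDerivAt.fun_sum fun j _ => (h j a b).const_mul _
lemma mHD.unique {M : ℝ → Matrix (Fin m) (Fin n) ℝ} {M' M''} (h1 : mHD M M' s) (h2 : mHD M M'' s) : M' = M'' := by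
  ext a b; exact (h1 a b).unique (h2 a b)
lemma mHD.congr {M L : ℝ → Matrix (Fin m) (Fin n) ℝ} {M'} (h1 : mHD M M' s) (h2 : L =ᶠ[𝓝 s] M) : mHD L M' s := by
  intro a b
  refine (h1 a b).congr_of_eventuallyEq ?_
  filter_upwards [h2] with r hr
  rw [hr]
end mHD

/-- the functional `∑ π_i tr(V_i Σ)` -/
def fc {d N : ℕ} (piv : Fin N → ℝ) (Sg : Matrix (Fin d) (Fin d) ℝ) (V : Fin N → Matrix (Fin d) (Fin d) ℝ) : ℝ :=
  ∑ i, piv i * (V i * Sg).trace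

lemma mHD.fc {d N : ℕ} (piv : Fin N → ℝ) (Sg : Matrix (Fin d) (Fin d) ℝ)
    {p : ℝ → Fin N → Matrix (Fin d) (Fin d) ℝ} {p'} {s}
    (h : ∀ i, mHD (fun r => p r i) (p' i) s) : HasDerivAt (fun r => fc piv Sg (p r)) (fc piv Sg p') s := by
  unfold MJLS.fc
  refine HasDerivAt.fun_sum fun i _ => HasDerivAt.const_mul _ ?_
  simp only [Matrix.trace, Matrix.diag_apply]
  refine HasDerivAt.fun_sum fun a _ => ?_
  have := ((h i).mul (mHD.const Sg)) a a
  simpa using this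

lemma deriv_two {f : ℝ → ℝ} {s : ℝ} (h : ContDiffAt ℝ 2 f s) :
    HasDerivAt f (deriv f s) s ∧ HasDerivAt (deriv f) (deriv (deriv f) s) s := by
  refine ⟨(h.differentiableAt (by norm_num)).hasDerivAt, ?_⟩
  have h1 : ContDiffAt ℝ 1 (deriv f) s := by
    have h2 : ContDiffAt ℝ 1 (fderiv ℝ f) s := h.fderiv_right (by norm_num)
    exact h2.clm_apply contDiffAt_const
  exact (h1.differentiableAt (by norm_num)).hasDerivAt

section line
variable {d k N : ℕ} (Pr : Matrix (Fin N) (Fin N) ℝ) (A : Fin N → Matrix (Fin d) (Fin d) ℝ)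
  (B : Fin N → Matrix (Fin d) (Fin k) ℝ)
  (Q : Fin N → Matrix (Fin d) (Fin d) ℝ) (R : Fin N → Matrix (Fin k) (Fin k) ℝ)

lemma continuous_calA_pow (t : ℕ) (p q) (K D : Fin N → Matrix (Fin k) (Fin d) ℝ) :
    Continuous (fun r : ℝ => (calA Pr (Gam A B (K + r • D)) ^ t) p q) := by
  have h : Continuous (fun r : ℝ => calA Pr (Gam A B (K + r • D))) := by
    refine continuous_matrix ?_
    rintro ⟨i, a, b⟩ ⟨j, c, e⟩
    simp only [calA_apply, Gam, Matrix.sub_apply, Matrix.mul_apply, Pi.add_apply, Pi.smul_apply,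
      Matrix.add_apply, Matrix.smul_apply]
    fun_prop
  exact (h.pow t).matrix_elem p q

lemma stab_eventually (hd : 0 < d) (hN : 0 < N) (K D : Fin N → Matrix (Fin k) (Fin d) ℝ) (s : ℝ)
    (h : stab Pr (Gam A B (K + s • D))) : ∀ᶠ r in 𝓝 s, stab Pr (Gam A B (K + r • D)) := by
  have : Nonempty (Fin N × Fin d × Fin d) := ⟨(⟨0, hN⟩, ⟨0, hd⟩, ⟨0, hd⟩)⟩
  obtain ⟨ρ, h0, h1, h2⟩ := sr_bound _ h
  obtain ⟨t, ht, ht0⟩ := (h2.and (eventually_gt_atTop 0)).exists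
  have hlt : ρ ^ t < 1 := pow_lt_one₀ h0 h1 ht0.ne'
  have : ∀ᶠ r in 𝓝 s, ∀ p, ∑ q, |(calA Pr (Gam A B (K + r • D)) ^ t) p q| < 1 := by
    rw [eventually_all]
    intro p
    have hc : Continuous (fun r : ℝ => ∑ q, |(calA Pr (Gam A B (K + r • D)) ^ t) p q|) :=
      continuous_finsetSum _ fun q _ => (continuous_calA_pow Pr A B t p q K D).abs
    exact hc.continuousAt.eventually_lt_const (lt_of_le_of_lt (ht p) hlt)
  filter_upwards [this] with r hr
  exact sr_of_row _ t hr

/-- first-order source -/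
def Zs (K D : Fin N → Matrix (Fin k) (Fin d) ℝ) (P : Fin N → Matrix (Fin d) (Fin d) ℝ) :
    Fin N → Matrix (Fin d) (Fin d) ℝ := fun i =>
  (D i)ᵀ * R i * K i + (K i)ᵀ * R i * D i - (B i * D i)ᵀ * opE Pr P i * Gam A B K i
    - (Gam A B K i)ᵀ * opE Pr P i * (B i * D i)

/-- second-order source -/
def Ys (K D : Fin N → Matrix (Fin k) (Fin d) ℝ) (P P' : Fin N → Matrix (Fin d) (Fin d) ℝ) :
    Fin N → Matrix (Fin d) (Fin d) ℝ := fun i =>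
  (2:ℝ) • ((D i)ᵀ * R i * D i + (B i * D i)ᵀ * opE Pr P i * (B i * D i)
    - (B i * D i)ᵀ * opE Pr P' i * Gam A B K i - (Gam A B K i)ᵀ * opE Pr P' i * (B i * D i))

section Normed
attribute [local instance] Matrix.normedAddCommGroup Matrix.normedSpace

lemma contDiffAt_line_entry (K D : Fin N → Matrix (Fin k) (Fin d) ℝ) (s : ℝ)
    (h : stab Pr (Gam A B (K + s • D))) (i a b) :
    ContDiffAt ℝ 2 (fun r : ℝ => PK Pr A B Q R (K + r • D) i a b) s := by
  have h1 := contDiffAt_PK Pr A B Q R h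
  have h2 : ContDiffAt ℝ 2 (fun r : ℝ => K + r • D) s := by fun_prop
  have h3 : ContDiffAt ℝ 2 (fun r : ℝ => PK Pr A B Q R (K + r • D)) s :=
    ContDiffAt.fun_comp (g := PK Pr A B Q R) (f := fun r : ℝ => K + r • D) s h1 h2
  exact contDiffAt_pi.1 (contDiffAt_pi.1 (contDiffAt_pi.1 h3 i) a) b

lemma cost_fderiv (piv : Fin N → ℝ) (Sg : Matrix (Fin d) (Fin d) ℝ) (K D : Fin N → Matrix (Fin k) (Fin d) ℝ)
    (h : stab Pr (Gam A B K)) (c : ℝ)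
    (hc : HasDerivAt (fun r : ℝ => cost Pr A B Q R piv Sg (K + r • D)) c 0) :
    fderiv ℝ (cost Pr A B Q R piv Sg) K D = c := by
  have h1 := contDiffAt_PK Pr A B Q R h
  have h2 : DifferentiableAt ℝ (cost Pr A B Q R piv Sg) K := by
    unfold cost
    refine DifferentiableAt.fun_sum fun i _ => DifferentiableAt.const_mul ?_ _
    simp only [Matrix.trace, Matrix.diag_apply, Matrix.mul_apply]
    refine DifferentiableAt.fun_sum fun a _ => DifferentiableAt.fun_sum fun b _ => DifferentiableAt.mul_const ?_ _
    have := contDiffAt_pi.1 (contDiffAt_pi.1 (contDiffAt_pi.1 h1 i) a) b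
    exact this.differentiableAt (by norm_num)
  have h3 : HasDerivAt (fun r : ℝ => K + r • D) D 0 := by
    have := ((hasDerivAt_id (0:ℝ)).smul_const D).const_add K
    simp only [id, one_smul] at this
    exact this
  have h4 : HasFDerivAt (cost Pr A B Q R piv Sg) (fderiv ℝ (cost Pr A B Q R piv Sg) K) (K + (0:ℝ) • D) := by
    simpa using h2.hasFDerivAt
  have h5 : HasDerivAt (fun r : ℝ => cost Pr A B Q R piv Sg (K + r • D))
      (fderiv ℝ (cost Pr A B Q R piv Sg) K D) 0 :=
    HasFDerivAt.comp_hasDerivAt (l := cost Pr A B Q R piv Sg) (f := fun r : ℝ => K + r • D) 0 h4 h3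
  exact h5.unique hc

end Normed

lemma line_deriv (hd : 0 < d) (hN : 0 < N) (K D : Fin N → Matrix (Fin k) (Fin d) ℝ) :
    ∃ p' p'' : ℝ → Fin N → Matrix (Fin d) (Fin d) ℝ, ∀ s, stab Pr (Gam A B (K + s • D)) →
      (p' s = Zs Pr A B R (K + s • D) D (PK Pr A B Q R (K + s • D)) + opL Pr (Gam A B (K + s • D)) (p' s)) ∧
      (p'' s = Ys Pr A B R (K + s • D) D (PK Pr A B Q R (K + s • D)) (p' s) + opL Pr (Gam A B (K + s • D)) (p'' s)) ∧
      (∀ i, mHD (fun r => PK Pr A B Q R (K + r • D) i) (p' s i) s) ∧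
      (∀ i, mHD (fun r => p' r i) (p'' s i) s) := by
  set p : ℝ → Fin N → Matrix (Fin d) (Fin d) ℝ := fun r => PK Pr A B Q R (K + r • D) with hp
  set p' : ℝ → Fin N → Matrix (Fin d) (Fin d) ℝ := fun r i => Matrix.of fun a b => deriv (fun r => p r i a b) r with hp'
  set p'' : ℝ → Fin N → Matrix (Fin d) (Fin d) ℝ := fun r i => Matrix.of fun a b => deriv (deriv (fun r => p r i a b)) r with hp''
  have H1 : ∀ s, stab Pr (Gam A B (K + s • D)) → ∀ i, mHD (fun r => p r i) (p' s i) s := by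
    intro s hs i a b
    exact (deriv_two (contDiffAt_line_entry Pr A B Q R K D s hs i a b)).1
  have H2 : ∀ s, stab Pr (Gam A B (K + s • D)) → ∀ i, mHD (fun r => p' r i) (p'' s i) s := by
    intro s hs i a b
    exact (deriv_two (contDiffAt_line_entry Pr A B Q R K D s hs i a b)).2
  have HG : ∀ s i, mHD (fun r => Gam A B (K + r • D) i) (- (B i * D i)) s := by
    intro s i
    have := (mHD.const (s := s) (A i)).sub ((mHD.const (s := s) (B i)).mul (mHD.line (s := s) (K i) (D i)))
    simpa [Gam] using this
  have HK : ∀ s i, mHD (fun r : ℝ => (K + r • D) i) (D i) s := fun s i => mHD.line (K i) (D i)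
  have F1 : ∀ s, stab Pr (Gam A B (K + s • D)) →
      p' s = Zs Pr A B R (K + s • D) D (p s) + opL Pr (Gam A B (K + s • D)) (p' s) := by
    intro s hs
    funext i
    have ev : (fun r => p r i) =ᶠ[𝓝 s] fun r => Q i + ((K + r • D) i)ᵀ * R i * ((K + r • D) i)
        + (Gam A B (K + r • D) i)ᵀ * opE Pr (p r) i * Gam A B (K + r • D) i := by
      filter_upwards [stab_eventually Pr A B hd hN K D s hs] with r hr
      exact congrFun (PK_fix Pr A B Q R hr) i
    have h1 := ((mHD.const (s := s) (Q i)).add (((HK s i).tr.mul (mHD.const (R i))).mul (HK s i))).add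
      (((HG s i).tr.mul (mHD.opE Pr (H1 s hs) i)).mul (HG s i))
    rw [(H1 s hs i).unique (h1.congr ev)]
    simp only [Pi.add_apply, Zs, opL, Matrix.transpose_neg, Matrix.neg_mul, Matrix.mul_neg, Matrix.mul_zero, add_zero, zero_add,
      Matrix.add_mul]
    abel
  refine ⟨p', p'', fun s hs => ⟨F1 s hs, ?_, H1 s hs, H2 s hs⟩⟩
  funext i
  have ev : (fun r => p' r i) =ᶠ[𝓝 s] fun r => (D i)ᵀ * R i * (K + r • D) i + ((K + r • D) i)ᵀ * R i * D i
      - (B i * D i)ᵀ * opE Pr (p r) i * Gam A B (K + r • D) i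
      - (Gam A B (K + r • D) i)ᵀ * opE Pr (p r) i * (B i * D i)
      + (Gam A B (K + r • D) i)ᵀ * opE Pr (p' r) i * Gam A B (K + r • D) i := by
    filter_upwards [stab_eventually Pr A B hd hN K D s hs] with r hr
    exact congrFun (F1 r hr) i
  have hE := mHD.opE Pr (H1 s hs) i
  have hE' := mHD.opE Pr (H2 s hs) i
  have h1 := ((((mHD.const (s := s) ((D i)ᵀ * R i)).mul (HK s i)).add
      (((HK s i).tr.mul (mHD.const (s := s) (R i))).mul (mHD.const (s := s) (D i)))).sub
      (((mHD.const (s := s) (B i * D i)ᵀ).mul hE).mul (HG s i))).sub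
      (((HG s i).tr.mul hE).mul (mHD.const (s := s) (B i * D i)))
  have h2 := h1.add (((HG s i).tr.mul hE').mul (HG s i))
  rw [(H2 s hs i).unique (h2.congr ev)]
  simp only [Pi.add_apply, Ys, opL, Matrix.transpose_neg, Matrix.neg_mul, Matrix.mul_neg, Matrix.mul_zero, add_zero, zero_add,
      Matrix.add_mul, Matrix.zero_mul, two_smul]
  abel

end line

/-- the standing assumptions -/
structure Hyp {d k N : ℕ} (Pr : Matrix (Fin N) (Fin N) ℝ) (piv : Fin N → ℝ) (Sg : Matrix (Fin d) (Fin d) ℝ)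
    (Q : Fin N → Matrix (Fin d) (Fin d) ℝ) (R : Fin N → Matrix (Fin k) (Fin k) ℝ) : Prop where
  hd : 0 < d
  hk : 0 < k
  hN : 0 < N
  hPr : ∀ i j, 0 ≤ Pr i j
  hPrSum : ∀ i, ∑ j, Pr i j = 1
  hpiv : ∀ i, 0 < piv i
  hSg : Sg.PosDef
  hQ : ∀ i, (Q i).PosDef
  hR : ∀ i, (R i).PosDef

lemma bf_sand {a b m n : ℕ} (X : Matrix (Fin m) (Fin a) ℝ) (M : Matrix (Fin m) (Fin n) ℝ) (Y : Matrix (Fin n) (Fin b) ℝ)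
    (x y) : bf (Xᵀ * M * Y) x y = bf M (X *ᵥ x) (Y *ᵥ y) := by
  rw [bf_mul, bf_tmul]

section fcl
variable {d N : ℕ} (piv : Fin N → ℝ) (Sg : Matrix (Fin d) (Fin d) ℝ)

/-- `fc` as a linear map -/
def fcl : (Fin N → Matrix (Fin d) (Fin d) ℝ) →ₗ[ℝ] ℝ where
  toFun := fc piv Sg
  map_add' V W := by simp [fc, Matrix.add_mul, mul_add, Finset.sum_add_distrib]
  map_smul' c V := by
    simp only [fc, Pi.smul_apply, Matrix.smul_mul, Matrix.trace_smul, smul_eq_mul, RingHom.id_apply, Finset.mul_sum]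
    exact Finset.sum_congr rfl fun i _ => by ring

lemma fc_add (V W) : fc piv Sg (V + W) = fc piv Sg V + fc piv Sg W := (fcl piv Sg).map_add V W
lemma fc_sub (V W) : fc piv Sg (V - W) = fc piv Sg V - fc piv Sg W := (fcl piv Sg).map_sub V W
lemma fc_smul (c : ℝ) (V) : fc piv Sg (c • V) = c * fc piv Sg V := (fcl piv Sg).map_smul c V
end fcl

section lam
variable {a b N : ℕ}
lemma le_maxNorm (V : Fin N → Matrix (Fin a) (Fin b) ℝ) (i) : specNorm (V i) ≤ maxNorm V :=
  le_ciSup (f := fun i => specNorm (V i)) (Set.finite_range _).bddAbove i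
lemma maxNorm_nonneg (V : Fin N → Matrix (Fin a) (Fin b) ℝ) : 0 ≤ maxNorm V :=
  Real.iSup_nonneg fun _ => specNorm_nonneg _
lemma lamMin_le (V : Fin N → Matrix (Fin a) (Fin a) ℝ) (i) : lamMin V ≤ sigmaMin (V i) :=
  ciInf_le (f := fun i => sigmaMin (V i)) (Set.finite_range _).bddBelow i
lemma ciInf_pos' (hN : 0 < N) {f : Fin N → ℝ} (h : ∀ i, 0 < f i) : 0 < ⨅ i, f i := by
  have : Nonempty (Fin N) := ⟨⟨0, hN⟩⟩
  obtain ⟨i, hi⟩ := exists_eq_ciInf_of_finite (f := f)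
  rw [← hi]; exact h i
lemma lamMin_pos (ha : 0 < a) (hN : 0 < N) {V : Fin N → Matrix (Fin a) (Fin a) ℝ} (h : ∀ i, (V i).PosDef) :
    0 < lamMin V := ciInf_pos' hN fun i => sigmaMin_pos ha (h i)
lemma lamMin_bf {V : Fin N → Matrix (Fin a) (Fin a) ℝ} (h : ∀ i, (V i).PosDef) (i x) :
    lamMin V * (x ⬝ᵥ x) ≤ bf (V i) x x :=
  (mul_le_mul_of_nonneg_right (lamMin_le V i) (dot_self_nonneg x)).trans (sigmaMin_bf (h i).posSemidef x)
lemma maxNorm_bf (V : Fin N → Matrix (Fin a) (Fin a) ℝ) (i x) : bf (V i) x x ≤ maxNorm V * (x ⬝ᵥ x) :=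
  (specNorm_bf _ x).trans (mul_le_mul_of_nonneg_right (le_maxNorm V i) (dot_self_nonneg x))
lemma maxNorm_dot (V : Fin N → Matrix (Fin a) (Fin b) ℝ) (i x) :
    (V i *ᵥ x) ⬝ᵥ (V i *ᵥ x) ≤ maxNorm V ^ 2 * (x ⬝ᵥ x) := by
  refine (specNorm_dot _ x).trans (mul_le_mul_of_nonneg_right ?_ (dot_self_nonneg x))
  exact pow_le_pow_left₀ (specNorm_nonneg _) (le_maxNorm V i) 2
end lam

section main
variable {d k N : ℕ} {Pr : Matrix (Fin N) (Fin N) ℝ} {piv : Fin N → ℝ} {Sg : Matrix (Fin d) (Fin d) ℝ}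
  {Q : Fin N → Matrix (Fin d) (Fin d) ℝ} {R : Fin N → Matrix (Fin k) (Fin k) ℝ}
  {A : Fin N → Matrix (Fin d) (Fin d) ℝ} {B : Fin N → Matrix (Fin d) (Fin k) ℝ}
  {K : Fin N → Matrix (Fin k) (Fin d) ℝ} {Γ : Fin N → Matrix (Fin d) (Fin d) ℝ} {α : ℝ}

lemma Hyp.mu_pos (H : Hyp Pr piv Sg Q R) : 0 < mu piv Sg :=
  mul_pos (ciInf_pos' H.hN H.hpiv) (sigmaMin_pos H.hd H.hSg)
lemma Hyp.lQ (H : Hyp Pr piv Sg Q R) : 0 < lamMin Q := lamMin_pos H.hd H.hN H.hQ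
lemma Hyp.lR (H : Hyp Pr piv Sg Q R) : 0 < lamMin R := lamMin_pos H.hk H.hN H.hR

lemma Hyp.fc_nonneg (H : Hyp Pr piv Sg Q R) {V : Fin N → Matrix (Fin d) (Fin d) ℝ} (hV : nn V) :
    0 ≤ fc piv Sg V :=
  Finset.sum_nonneg fun i _ => mul_nonneg (H.hpiv i).le (trace_mul_psd_nonneg (hV i) H.hSg.posSemidef)

lemma Hyp.fc_mono (H : Hyp Pr piv Sg Q R) {V W : Fin N → Matrix (Fin d) (Fin d) ℝ} (hV : nn (W - V)) :
    fc piv Sg V ≤ fc piv Sg W := by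
  have := H.fc_nonneg hV
  rw [fc_sub] at this; linarith

lemma Hyp.fc_mu (H : Hyp Pr piv Sg Q R) {V : Fin N → Matrix (Fin d) (Fin d) ℝ} (hV : nn V) :
    mu piv Sg * ∑ i, (V i).trace ≤ fc piv Sg V := by
  rw [Finset.mul_sum]
  refine Finset.sum_le_sum fun i _ => ?_
  have h1 : sigmaMin Sg * (V i).trace ≤ (V i * Sg).trace := by
    have := trace_mul_psd_nonneg (hV i) (psd_sub_sigmaMin H.hSg.posSemidef)
    simp only [Matrix.mul_sub, Matrix.trace_sub, Matrix.mul_smul, Matrix.mul_one, Matrix.trace_smul, smul_eq_mul] at this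
    linarith
  have h2 : (⨅ i, piv i) ≤ piv i := ciInf_le (Set.finite_range _).bddBelow i
  have h3 : 0 ≤ (⨅ i, piv i) := (ciInf_pos' H.hN H.hpiv).le
  have h4 : 0 ≤ sigmaMin Sg * (V i).trace := mul_nonneg (sigmaMin_nonneg _) (trace_nn (hV i))
  calc mu piv Sg * (V i).trace = (⨅ i, piv i) * (sigmaMin Sg * (V i).trace) := by unfold mu; ring
    _ ≤ piv i * (V i * Sg).trace := mul_le_mul h2 h1 h4 (H.hpiv i).le

lemma opE_transpose (V : Fin N → Matrix (Fin d) (Fin d) ℝ) (i) : (opE Pr V i)ᵀ = opE Pr (fun j => (V j)ᵀ) i := by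
  simp [opE, Matrix.transpose_sum, Matrix.transpose_smul]

lemma Hyp.P_symm (H : Hyp Pr piv Sg Q R) (h : stab Pr (Gam A B K)) (i) :
    (PK Pr A B Q R K i)ᵀ = PK Pr A B Q R K i := by
  have h1 : (fun i => (PK Pr A B Q R K i)ᵀ) = src Q R K + opL Pr (Gam A B K) (fun i => (PK Pr A B Q R K i)ᵀ) := by
    funext i
    have h0 := congrArg Matrix.transpose (congrFun (PK_fix Pr A B Q R h) i)
    have hq : (Q i)ᵀ = Q i := by simpa using (H.hQ i).isHermitian.eq
    have hr : (R i)ᵀ = R i := by simpa using (H.hR i).isHermitian.eq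
    rw [h0]
    simp only [Pi.add_apply, src, opL, Matrix.transpose_add, Matrix.transpose_mul, Matrix.transpose_transpose,
      hq, hr, opE_transpose, Matrix.mul_assoc]
  have := (sol_unique h.isUnit h1).trans (sol_unique h.isUnit (PK_fix Pr A B Q R h)).symm
  exact congrFun this i

lemma E_symm {P : Fin N → Matrix (Fin d) (Fin d) ℝ} (hP : ∀ i, (P i)ᵀ = P i) (i) : (opE Pr P i)ᵀ = opE Pr P i := by
  rw [opE_transpose]; simp only [hP]

lemma Hyp.Rq_nn (H : Hyp Pr piv Sg Q R) : nn (fun i => (K i)ᵀ * R i * K i) := by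
  intro i x
  have : bf ((K i)ᵀ * R i * K i) x x = bf (R i) (K i *ᵥ x) (K i *ᵥ x) := by
    rw [Matrix.mul_assoc, bf_tmul, bf_mul]
  rw [this]; exact psd_bf (H.hR i).posSemidef _

lemma Hyp.src_nn (H : Hyp Pr piv Sg Q R) : nn (src Q R K) := by
  intro i x
  rw [src, bf_add]
  exact add_nonneg (psd_bf (H.hQ i).posSemidef _) (H.Rq_nn i x)

lemma Hyp.P_nn (H : Hyp Pr piv Sg Q R) (h : stab Pr (Gam A B K)) : nn (PK Pr A B Q R K) :=
  h.nn_of_fix H.hPr (PK_fix Pr A B Q R h) H.src_nn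

lemma Hyp.P_psd (H : Hyp Pr piv Sg Q R) (h : stab Pr (Gam A B K)) (i) : (PK Pr A B Q R K i).PosSemidef := by
  refine Matrix.PosSemidef.of_dotProduct_mulVec_nonneg ?_ ?_
  · simpa [Matrix.IsHermitian] using H.P_symm h i
  · intro x; simpa [bf] using H.P_nn h i x

/-- expansion of the Lyapunov equation in quadratic form -/
lemma bf_P (h : stab Pr (Gam A B K)) (i x) : bf (PK Pr A B Q R K i) x x = bf (Q i) x x
    + bf (R i) (K i *ᵥ x) (K i *ᵥ x) + bf (opE Pr (PK Pr A B Q R K) i) (Gam A B K i *ᵥ x) (Gam A B K i *ᵥ x) := by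
  conv_lhs => rw [PK_fix Pr A B Q R h]
  rw [Pi.add_apply, bf_add, src, bf_add, opL]
  rw [bf_sand, bf_sand]

lemma Hyp.P_bound (H : Hyp Pr piv Sg Q R) (h : stab Pr (Gam A B K)) (hα : cost Pr A B Q R piv Sg K ≤ α) (i x) :
    bf (PK Pr A B Q R K i) x x ≤ α / mu piv Sg * (x ⬝ᵥ x) := by
  refine (bf_le_trace (H.P_psd h i) x).trans (mul_le_mul_of_nonneg_right ?_ (dot_self_nonneg x))
  rw [le_div_iff₀ H.mu_pos]
  have h1 := H.fc_mu (H.P_nn h)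
  have h2 : (PK Pr A B Q R K i).trace ≤ ∑ i, (PK Pr A B Q R K i).trace :=
    Finset.single_le_sum (f := fun i => (PK Pr A B Q R K i).trace) (fun j _ => trace_nn (H.P_nn h j)) (Finset.mem_univ i)
  have h3 : fc piv Sg (PK Pr A B Q R K) ≤ α := hα
  nlinarith [mul_le_mul_of_nonneg_left h2 H.mu_pos.le]

lemma Hyp.E_bound (H : Hyp Pr piv Sg Q R) {V : Fin N → Matrix (Fin d) (Fin d) ℝ} {c : ℝ}
    (hV : ∀ i x, bf (V i) x x ≤ c * (x ⬝ᵥ x)) (i x) :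
    bf (opE Pr V i) x x ≤ c * (x ⬝ᵥ x) := by
  rw [bf_opE]
  calc ∑ j, Pr i j * bf (V j) x x ≤ ∑ j, Pr i j * (c * (x ⬝ᵥ x)) :=
        Finset.sum_le_sum fun j _ => mul_le_mul_of_nonneg_left (hV j x) (H.hPr i j)
    _ = c * (x ⬝ᵥ x) := by rw [← Finset.sum_mul, H.hPrSum, one_mul]

lemma Hyp.cost_nonneg (H : Hyp Pr piv Sg Q R) (h : stab Pr (Gam A B K)) : 0 ≤ cost Pr A B Q R piv Sg K :=
  H.fc_nonneg (H.P_nn h)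

lemma Hyp.lQ_le (H : Hyp Pr piv Sg Q R) (h : stab Pr (Gam A B K)) (hα : cost Pr A B Q R piv Sg K ≤ α) :
    lamMin Q ≤ α / mu piv Sg := by
  let i : Fin N := ⟨0, H.hN⟩
  let x : Fin d → ℝ := Pi.single ⟨0, H.hd⟩ 1
  have hx : x ⬝ᵥ x = 1 := by simp [x]
  have h1 := H.P_bound h hα i x
  have h2 := lamMin_bf H.hQ i x
  have h3 := bf_P (Q := Q) (R := R) h i x
  have h4 := psd_bf (H.hR i).posSemidef (K i *ᵥ x)
  have h5 := opE_nn H.hPr (H.P_nn h) i (Gam A B K i *ᵥ x)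
  rw [hx] at h1 h2
  linarith

/-- the functional `J(Z)` -/
noncomputable def J (Pr : Matrix (Fin N) (Fin N) ℝ) (piv : Fin N → ℝ) (Sg : Matrix (Fin d) (Fin d) ℝ) (Γ : Fin N → Matrix (Fin d) (Fin d) ℝ) :
    (Fin N → Matrix (Fin d) (Fin d) ℝ) →ₗ[ℝ] ℝ := (fcl piv Sg) ∘ₗ (sol Pr Γ)

lemma J_fix (h : stab Pr Γ) {V Z : Fin N → Matrix (Fin d) (Fin d) ℝ} (hV : V = Z + opL Pr Γ V) :
    J Pr piv Sg Γ Z = fc piv Sg V := by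
  rw [sol_unique h.isUnit hV]; rfl

lemma Hyp.J_nonneg (H : Hyp Pr piv Sg Q R) (h : stab Pr Γ) {Z : Fin N → Matrix (Fin d) (Fin d) ℝ} (hZ : nn Z) :
    0 ≤ J Pr piv Sg Γ Z := H.fc_nonneg (sol_nn H.hPr h hZ)

lemma Hyp.J_mono (H : Hyp Pr piv Sg Q R) (h : stab Pr Γ) {V W : Fin N → Matrix (Fin d) (Fin d) ℝ}
    (hV : ∀ i x, bf (V i) x x ≤ bf (W i) x x) : J Pr piv Sg Γ V ≤ J Pr piv Sg Γ W := by
  have : nn (W - V) := fun i x => by rw [Pi.sub_apply, bf_sub]; linarith [hV i x]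
  have := H.J_nonneg h this
  rw [map_sub] at this; linarith

lemma Hyp.fc_le_J (H : Hyp Pr piv Sg Q R) (h : stab Pr Γ) {Z : Fin N → Matrix (Fin d) (Fin d) ℝ} (hZ : nn Z) :
    fc piv Sg Z ≤ J Pr piv Sg Γ Z := by
  refine H.fc_mono ?_
  have := sol_eq h.isUnit Z
  rw [eq_comm, ← sub_eq_iff_eq_add'.trans eq_comm] at this
  rw [sub_eq_iff_eq_add'.2 (sol_eq h.isUnit Z)]
  exact opL_nn H.hPr (sol_nn H.hPr h hZ)

lemma Hyp.cost_eq_J (h : stab Pr (Gam A B K)) :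
    cost Pr A B Q R piv Sg K = J Pr piv Sg (Gam A B K) (src Q R K) :=
  (J_fix h (PK_fix Pr A B Q R h)).symm

lemma Hyp.J_one (H : Hyp Pr piv Sg Q R) (h : stab Pr (Gam A B K)) (hα : cost Pr A B Q R piv Sg K ≤ α) :
    J Pr piv Sg (Gam A B K) 1 ≤ α / lamMin Q := by
  rw [le_div_iff₀ H.lQ]
  refine le_trans ?_ hα
  rw [Hyp.cost_eq_J h, mul_comm, ← smul_eq_mul, ← map_smul]
  refine H.J_mono h fun i x => ?_
  rw [src, bf_add, Pi.smul_apply, Pi.one_apply, bf_smul, bf_one]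
  linarith [lamMin_bf H.hQ i x, H.Rq_nn (K := K) i x]

lemma Hyp.J_opL (H : Hyp Pr piv Sg Q R) (h : stab Pr Γ) {Z : Fin N → Matrix (Fin d) (Fin d) ℝ} (hZ : nn Z) :
    J Pr piv Sg Γ (opL Pr Γ Z) ≤ J Pr piv Sg Γ Z := by
  have h1 : J Pr piv Sg Γ (opL Pr Γ Z) = fc piv Sg (sol Pr Γ Z - Z) := by
    refine J_fix h ?_
    rw [opL_sub]
    have := sol_eq h.isUnit Z
    conv_lhs => rw [this]
    abel
  rw [h1, fc_sub]
  have := H.fc_nonneg hZ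
  have h2 : J Pr piv Sg Γ Z = fc piv Sg (sol Pr Γ Z) := rfl
  linarith

end main
section main
variable {d k N : ℕ} {Pr : Matrix (Fin N) (Fin N) ℝ} {piv : Fin N → ℝ} {Sg : Matrix (Fin d) (Fin d) ℝ}
  {Q : Fin N → Matrix (Fin d) (Fin d) ℝ} {R : Fin N → Matrix (Fin k) (Fin k) ℝ}
  {A : Fin N → Matrix (Fin d) (Fin d) ℝ} {B : Fin N → Matrix (Fin d) (Fin k) ℝ}
  {K D : Fin N → Matrix (Fin k) (Fin d) ℝ} {α : ℝ}

lemma ip_term_nonneg {m n : ℕ} (X : Matrix (Fin m) (Fin n) ℝ) : 0 ≤ (Xᵀ * X).trace := by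
  refine trace_nn fun x => ?_
  rw [bf_mul, bf_t]; exact dot_self_nonneg _

lemma D_dot (D : Fin N → Matrix (Fin k) (Fin d) ℝ) (i) (x : Fin d → ℝ) :
    (D i *ᵥ x) ⬝ᵥ (D i *ᵥ x) ≤ ip D D * (x ⬝ᵥ x) := by
  refine (mulVec_dot_le _ x).trans (mul_le_mul_of_nonneg_right ?_ (dot_self_nonneg x))
  exact Finset.single_le_sum (f := fun i => ((D i)ᵀ * D i).trace) (fun j _ => ip_term_nonneg _) (Finset.mem_univ i)

lemma BD_dot (B : Fin N → Matrix (Fin d) (Fin k) ℝ) (D : Fin N → Matrix (Fin k) (Fin d) ℝ) (i) (x : Fin d → ℝ) :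
    ((B i * D i) *ᵥ x) ⬝ᵥ ((B i * D i) *ᵥ x) ≤ maxNorm B ^ 2 * (ip D D * (x ⬝ᵥ x)) := by
  rw [← Matrix.mulVec_mulVec]
  refine (maxNorm_dot B i _).trans (mul_le_mul_of_nonneg_left (D_dot D i x) (sq_nonneg _))

lemma bf_Zs (P : Fin N → Matrix (Fin d) (Fin d) ℝ) (i x) :
    bf (Zs Pr A B R K D P i) x x = (bf (R i) (D i *ᵥ x) (K i *ᵥ x) + bf (R i) (K i *ᵥ x) (D i *ᵥ x))
     - (bf (opE Pr P i) ((B i * D i) *ᵥ x) (Gam A B K i *ᵥ x) + bf (opE Pr P i) (Gam A B K i *ᵥ x) ((B i * D i) *ᵥ x)) := by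
  simp only [Zs, bf_add, bf_sub, bf_sand]; ring

lemma bf_Ys (P P' : Fin N → Matrix (Fin d) (Fin d) ℝ) (i x) :
    bf (Ys Pr A B R K D P P' i) x x = 2 * (bf (R i) (D i *ᵥ x) (D i *ᵥ x)
      + bf (opE Pr P i) ((B i * D i) *ᵥ x) ((B i * D i) *ᵥ x)
     - (bf (opE Pr P' i) ((B i * D i) *ᵥ x) (Gam A B K i *ᵥ x) + bf (opE Pr P' i) (Gam A B K i *ᵥ x) ((B i * D i) *ᵥ x))) := by
  simp only [Ys, bf_smul, bf_add, bf_sub, bf_sand]; ring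

lemma Hyp.xi_nonneg (H : Hyp Pr piv Sg Q R) (h : stab Pr (Gam A B K)) (hα : cost Pr A B Q R piv Sg K ≤ α) :
    0 ≤ xi B R Q piv Sg α := by
  have h1 := H.lQ_le h hα
  have h2 := H.lQ
  have h3 := maxNorm_nonneg R
  unfold xi
  rw [sub_nonneg, one_div, inv_mul_eq_div, le_div_iff₀ h2, mul_div_assoc]
  nlinarith [sq_nonneg (maxNorm B)]

lemma Hyp.Z_bound (H : Hyp Pr piv Sg Q R) (h : stab Pr (Gam A B K)) (hα : cost Pr A B Q R piv Sg K ≤ α)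
    {δ : ℝ} (hδ : 0 < δ) (hD : ip D D = δ ^ 2) (i x) :
    |bf (Zs Pr A B R K D (PK Pr A B Q R K) i) x x| ≤ δ * xi B R Q piv Sg α * bf (Q i) x x := by
  rw [bf_Zs]
  set u := (B i * D i) *ᵥ x with hu
  set g := Gam A B K i *ᵥ x with hg
  set w := D i *ᵥ x with hw
  set v := K i *ᵥ x with hv
  set E := opE Pr (PK Pr A B Q R K) i with hE
  set a := α / mu piv Sg with ha
  have hRn : ∀ y, 0 ≤ bf (R i) y y := psd_bf (H.hR i).posSemidef
  have hEn : ∀ y, 0 ≤ bf E y y := opE_nn H.hPr (H.P_nn h) i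
  have e1 := bf_polar (R i) (R i) (fun _ => le_rfl) (fun y => by linarith [hRn y]) w v δ⁻¹ (inv_pos.2 hδ)
  have e2 := bf_polar E E (fun _ => le_rfl) (fun y => by linarith [hEn y]) u g δ⁻¹ (inv_pos.2 hδ)
  rw [inv_inv] at e1 e2
  have hX := dot_self_nonneg x
  have a0 : 0 ≤ a := H.lQ.le.trans (H.lQ_le h hα)
  have f1 : bf (R i) w w ≤ maxNorm R * (δ ^ 2 * (x ⬝ᵥ x)) :=
    (maxNorm_bf R i w).trans (mul_le_mul_of_nonneg_left (hD ▸ D_dot D i x) (maxNorm_nonneg R))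
  have f2 : bf E u u ≤ a * (maxNorm B ^ 2 * (δ ^ 2 * (x ⬝ᵥ x))) :=
    (H.E_bound (H.P_bound h hα) i u).trans (mul_le_mul_of_nonneg_left (hD ▸ BD_dot B D i x) a0)
  have hP := bf_P (Q := Q) (R := R) h i x
  have hPb := H.P_bound h hα i x
  have hq := lamMin_bf H.hQ i x
  have g1 : δ⁻¹ * bf (R i) w w ≤ δ * (maxNorm R * (x ⬝ᵥ x)) := by
    rw [inv_mul_le_iff₀ hδ]; refine f1.trans (le_of_eq (by ring))
  have g2 : δ⁻¹ * bf E u u ≤ δ * (a * maxNorm B ^ 2 * (x ⬝ᵥ x)) := by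
    rw [inv_mul_le_iff₀ hδ]; refine f2.trans (le_of_eq (by ring))
  have hxi : xi B R Q piv Sg α * bf (Q i) x x =
      ((1 + maxNorm B ^ 2) * a + maxNorm R) * (bf (Q i) x x / lamMin Q) - bf (Q i) x x := by
    unfold xi; rw [ha]; ring
  have hdiv : x ⬝ᵥ x ≤ bf (Q i) x x / lamMin Q := by
    rw [le_div_iff₀ H.lQ]; linarith
  have hc : 0 ≤ (1 + maxNorm B ^ 2) * a + maxNorm R := by
    have := maxNorm_nonneg R; positivity
  have hc2 := mul_le_mul_of_nonneg_left hdiv hc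
  calc _ ≤ _ := abs_sub _ _
    _ ≤ (δ⁻¹ * bf (R i) w w + δ * bf (R i) v v) + (δ⁻¹ * bf E u u + δ * bf E g g) := add_le_add e1 e2
    _ ≤ δ * (maxNorm R * (x ⬝ᵥ x) + a * maxNorm B ^ 2 * (x ⬝ᵥ x) + (bf (R i) v v + bf E g g)) := by linarith
    _ ≤ δ * (xi B R Q piv Sg α * bf (Q i) x x) := by
      refine mul_le_mul_of_nonneg_left ?_ hδ.le
      rw [hxi]; linarith
    _ = _ := by ring

lemma Hyp.dp_bound (H : Hyp Pr piv Sg Q R) (h : stab Pr (Gam A B K)) (hα : cost Pr A B Q R piv Sg K ≤ α)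
    {δ : ℝ} (hδ : 0 < δ) (hD : ip D D = δ ^ 2) {p' : Fin N → Matrix (Fin d) (Fin d) ℝ}
    (hp : p' = Zs Pr A B R K D (PK Pr A B Q R K) + opL Pr (Gam A B K) p') (i x) :
    bf (p' i) x x ≤ δ * xi B R Q piv Sg α * bf (PK Pr A B Q R K i) x x ∧
    - (δ * xi B R Q piv Sg α * bf (PK Pr A B Q R K i) x x) ≤ bf (p' i) x x := by
  set c := δ * xi B R Q piv Sg α with hc
  have c0 : 0 ≤ c := mul_nonneg hδ.le (H.xi_nonneg h hα)
  have hPf := PK_fix Pr A B Q R h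
  have n1 : nn (c • PK Pr A B Q R K - p') := by
    refine h.nn_of_fix H.hPr (Z := c • src Q R K - Zs Pr A B R K D (PK Pr A B Q R K)) ?_ ?_
    · rw [opL_sub, opL_smul]
      conv_lhs => rw [hPf, hp, smul_add]
      abel
    · intro i x
      rw [Pi.sub_apply, Pi.smul_apply, bf_sub, bf_smul, src, bf_add]
      have := abs_le.1 (H.Z_bound h hα hδ hD i x)
      have h3 := mul_nonneg c0 (H.Rq_nn (K := K) i x)
      linarith [this.2]
  have n2 : nn (c • PK Pr A B Q R K + p') := by
    refine h.nn_of_fix H.hPr (Z := c • src Q R K + Zs Pr A B R K D (PK Pr A B Q R K)) ?_ ?_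
    · rw [opL_add, opL_smul]
      conv_lhs => rw [hPf, hp, smul_add]
      abel
    · intro i x
      rw [Pi.add_apply, Pi.smul_apply, bf_add, bf_smul, src, bf_add]
      have := abs_le.1 (H.Z_bound h hα hδ hD i x)
      have h3 := mul_nonneg c0 (H.Rq_nn (K := K) i x)
      linarith [this.1]
  have m1 := n1 i x
  have m2 := n2 i x
  rw [Pi.sub_apply, Pi.smul_apply, bf_sub, bf_smul] at m1
  rw [Pi.add_apply, Pi.smul_apply, bf_add, bf_smul] at m2
  constructor <;> linarith

lemma Hyp.cross (H : Hyp Pr piv Sg Q R) (h : stab Pr (Gam A B K)) (hα : cost Pr A B Q R piv Sg K ≤ α)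
    {δ : ℝ} (hδ : 0 < δ) (hD : ip D D = δ ^ 2) {p' : Fin N → Matrix (Fin d) (Fin d) ℝ}
    (hp : p' = Zs Pr A B R K D (PK Pr A B Q R K) + opL Pr (Gam A B K) p') (i x) :
    |bf (opE Pr p' i) ((B i * D i) *ᵥ x) (Gam A B K i *ᵥ x) + bf (opE Pr p' i) (Gam A B K i *ᵥ x) ((B i * D i) *ᵥ x)|
     ≤ xi B R Q piv Sg α * (α / mu piv Sg) * maxNorm B * δ ^ 2 *
        (x ⬝ᵥ x + (Gam A B K i *ᵥ x) ⬝ᵥ (Gam A B K i *ᵥ x)) := by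
  have hu2 := BD_dot B D i x
  rw [hD] at hu2
  set u := (B i * D i) *ᵥ x with hu
  set g := Gam A B K i *ᵥ x with hg
  set a := α / mu piv Sg with ha
  set ξ := xi B R Q piv Sg α with hξ
  set b := maxNorm B with hb
  have hX := dot_self_nonneg x
  have a0 : 0 ≤ a := H.lQ.le.trans (H.lQ_le h hα)
  have ξ0 : 0 ≤ ξ := H.xi_nonneg h hα
  rcases (maxNorm_nonneg B).eq_or_lt with h0 | h0
  · rw [← hb] at h0
    have : u ⬝ᵥ u = 0 := le_antisymm (by rw [← h0] at hu2; simpa using hu2) (dot_self_nonneg u)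
    have : u = 0 := dotProduct_self_eq_zero.1 this
    rw [this, ← h0]
    simp [bf]
  · rw [← hb] at h0
    have hE : ∀ y, bf (opE Pr p' i) y y ≤ bf ((δ * ξ) • opE Pr (PK Pr A B Q R K) i) y y := by
      intro y
      rw [bf_smul, bf_opE, bf_opE, Finset.mul_sum]
      refine Finset.sum_le_sum fun j _ => ?_
      have := mul_le_mul_of_nonneg_left (H.dp_bound h hα hδ hD hp j y).1 (H.hPr i j)
      linarith
    have hE' : ∀ y, -bf ((δ * ξ) • opE Pr (PK Pr A B Q R K) i) y y ≤ bf (opE Pr p' i) y y := by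
      intro y
      rw [bf_smul, bf_opE, bf_opE, Finset.mul_sum, ← Finset.sum_neg_distrib]
      refine Finset.sum_le_sum fun j _ => ?_
      have := mul_le_mul_of_nonneg_left (H.dp_bound h hα hδ hD hp j y).2 (H.hPr i j)
      linarith
    have key := bf_polar _ _ hE hE' u g (1 / (b * δ)) (by positivity)
    have f2 : bf (opE Pr (PK Pr A B Q R K) i) u u ≤ a * (b ^ 2 * (δ ^ 2 * (x ⬝ᵥ x))) :=
      (H.E_bound (H.P_bound h hα) i u).trans (mul_le_mul_of_nonneg_left hu2 a0)
    have f3 : bf (opE Pr (PK Pr A B Q R K) i) g g ≤ a * (g ⬝ᵥ g) := H.E_bound (H.P_bound h hα) i g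
    rw [bf_smul, bf_smul] at key
    refine key.trans ?_
    calc _ ≤ 1 / (b * δ) * (δ * ξ * (a * (b ^ 2 * (δ ^ 2 * (x ⬝ᵥ x))))) + (1 / (b * δ))⁻¹ * (δ * ξ * (a * (g ⬝ᵥ g))) := by
          gcongr
      _ = _ := by field_simp

lemma Hyp.smooth (H : Hyp Pr piv Sg Q R) (h : stab Pr (Gam A B K)) (hα : cost Pr A B Q R piv Sg K ≤ α)
    (hD0 : 0 < ip D D) {p' p'' : Fin N → Matrix (Fin d) (Fin d) ℝ}
    (hp : p' = Zs Pr A B R K D (PK Pr A B Q R K) + opL Pr (Gam A B K) p')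
    (hp2 : p'' = Ys Pr A B R K D (PK Pr A B Q R K) p' + opL Pr (Gam A B K) p'') :
    fc piv Sg p'' ≤ Lsm B R Q piv Sg α * ip D D := by
  obtain ⟨δ, hδ, hD⟩ : ∃ δ : ℝ, 0 < δ ∧ ip D D = δ ^ 2 :=
    ⟨Real.sqrt (ip D D), Real.sqrt_pos.2 hD0, (Real.sq_sqrt hD0.le).symm⟩
  rw [← J_fix h hp2]
  set a := α / mu piv Sg with ha
  set ξ := xi B R Q piv Sg α with hξ
  set b := maxNorm B with hb
  have a0 : 0 ≤ a := H.lQ.le.trans (H.lQ_le h hα)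
  have ξ0 : 0 ≤ ξ := H.xi_nonneg h hα
  have b0 : 0 ≤ b := maxNorm_nonneg B
  have r0 := maxNorm_nonneg R
  set c := 2 * ξ * a * b * δ ^ 2 with hc
  set e := 2 * (maxNorm R + a * b ^ 2) * δ ^ 2 + c with he
  have c0 : 0 ≤ c := by positivity
  have e0 : 0 ≤ e := by positivity
  have hone : nn (1 : Fin N → Matrix (Fin d) (Fin d) ℝ) := by
    intro i x; rw [Pi.one_apply, bf_one]; exact dot_self_nonneg x
  have h1 : J Pr piv Sg (Gam A B K) (Ys Pr A B R K D (PK Pr A B Q R K) p') ≤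
      J Pr piv Sg (Gam A B K) (e • 1 + c • opL Pr (Gam A B K) 1) := by
    refine H.J_mono h fun i x => ?_
    have hgg : bf (opL Pr (Gam A B K) 1 i) x x = (Gam A B K i *ᵥ x) ⬝ᵥ (Gam A B K i *ᵥ x) := by
      rw [bf_opL, bf_opE]
      simp only [Pi.one_apply, bf_one]
      rw [← Finset.sum_mul, H.hPrSum, one_mul]
    rw [bf_Ys, Pi.add_apply, bf_add, Pi.smul_apply, Pi.smul_apply, bf_smul, bf_smul, hgg, Pi.one_apply, bf_one]
    have hcr := abs_le.1 (H.cross h hα hδ hD hp i x)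
    have f1 : bf (R i) (D i *ᵥ x) (D i *ᵥ x) ≤ maxNorm R * (δ ^ 2 * (x ⬝ᵥ x)) :=
      (maxNorm_bf R i _).trans (mul_le_mul_of_nonneg_left (hD ▸ D_dot D i x) (maxNorm_nonneg R))
    have f2 : bf (opE Pr (PK Pr A B Q R K) i) ((B i * D i) *ᵥ x) ((B i * D i) *ᵥ x) ≤ a * (b ^ 2 * (δ ^ 2 * (x ⬝ᵥ x))) :=
      (H.E_bound (H.P_bound h hα) i _).trans (mul_le_mul_of_nonneg_left (hD ▸ BD_dot B D i x) a0)
    have := hcr.1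
    rw [he, hc]
    linarith
  refine h1.trans ?_
  rw [map_add, map_smul, map_smul, smul_eq_mul, smul_eq_mul]
  have h2 := H.J_opL h hone
  have h3 := H.J_one h hα
  have h4 : Lsm B R Q piv Sg α * ip D D = (e + c) * (α / lamMin Q) := by
    have : maxNorm B ^ 2 * (2 * ξ / maxNorm B) = 2 * ξ * b := by
      rw [← hb]
      rcases b0.eq_or_lt with h0 | h0
      · rw [← h0]; simp
      · field_simp
    rw [hD, he, hc]
    unfold Lsm
    calc _ = 2 * (maxNorm R + (maxNorm B ^ 2 + maxNorm B ^ 2 * (2 * ξ / maxNorm B)) * a) * δ ^ 2 * (α / lamMin Q) := by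
          rw [ha]; ring
      _ = _ := by rw [this]; ring
  rw [h4]
  nlinarith [mul_le_mul_of_nonneg_left h2 c0, mul_le_mul_of_nonneg_left h3 (add_nonneg e0 c0)]

end main
section main
variable {d k N : ℕ} {Pr : Matrix (Fin N) (Fin N) ℝ} {piv : Fin N → ℝ} {Sg : Matrix (Fin d) (Fin d) ℝ}
  {Q : Fin N → Matrix (Fin d) (Fin d) ℝ} {R : Fin N → Matrix (Fin k) (Fin k) ℝ}
  {A : Fin N → Matrix (Fin d) (Fin d) ℝ} {B : Fin N → Matrix (Fin d) (Fin k) ℝ}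
  {K D : Fin N → Matrix (Fin k) (Fin d) ℝ} {Γ : Fin N → Matrix (Fin d) (Fin d) ℝ} {α : ℝ}

/-- domination of a bilinear form by a quadratic form -/
def dom (V U : Fin N → Matrix (Fin d) (Fin d) ℝ) : Prop :=
  ∀ i x y, 2 * |bf (V i) x y| ≤ bf (U i) x x + bf (U i) y y

lemma dom.opL (hPr : ∀ i j, 0 ≤ Pr i j) {V U : Fin N → Matrix (Fin d) (Fin d) ℝ} (h : dom V U) :
    dom (opL Pr Γ V) (opL Pr Γ U) := by
  intro i x y
  simp only [bf_opL, bf_opE]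
  rw [← Finset.sum_add_distrib]
  calc _ ≤ 2 * ∑ j, |Pr i j * bf (V j) (Γ i *ᵥ x) (Γ i *ᵥ y)| :=
        mul_le_mul_of_nonneg_left (Finset.abs_sum_le_sum_abs _ _) (by norm_num)
    _ ≤ _ := by
      rw [Finset.mul_sum]
      refine Finset.sum_le_sum fun j _ => ?_
      rw [abs_mul, abs_of_nonneg (hPr i j)]
      have := mul_le_mul_of_nonneg_left (h j (Γ i *ᵥ x) (Γ i *ᵥ y)) (hPr i j)
      linarith

lemma dom.iter (hPr : ∀ i j, 0 ≤ Pr i j) {V U : Fin N → Matrix (Fin d) (Fin d) ℝ} (h : dom V U) (t : ℕ) :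
    dom ((MJLS.opL Pr Γ)^[t] V) ((MJLS.opL Pr Γ)^[t] U) := by
  induction t with
  | zero => exact h
  | succ t ih => rw [Function.iterate_succ_apply', Function.iterate_succ_apply']; exact ih.opL hPr

lemma bf_entry_bound {V : Matrix (Fin d) (Fin d) ℝ} (hV : ∀ a b, |V a b| ≤ 1) (x y : Fin d → ℝ) :
    2 * |bf V x y| ≤ d * (x ⬝ᵥ x + y ⬝ᵥ y) := by
  have h1 : bf V x y = ∑ a, ∑ b, x a * (V a b * y b) := by
    simp [bf, dotProduct, Matrix.mulVec, Finset.mul_sum]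
  have h2 : (d : ℝ) * (x ⬝ᵥ x + y ⬝ᵥ y) = ∑ a, ∑ b, (x a * x a + y b * y b) := by
    simp only [Finset.sum_add_distrib, Finset.sum_const, Finset.card_univ, Fintype.card_fin, nsmul_eq_mul, dotProduct,
      Finset.mul_sum, mul_add]
  rw [h1, h2]
  calc _ ≤ 2 * ∑ a, ∑ b, |x a * (V a b * y b)| := by
        refine mul_le_mul_of_nonneg_left ?_ (by norm_num)
        refine (Finset.abs_sum_le_sum_abs _ _).trans (Finset.sum_le_sum fun a _ => Finset.abs_sum_le_sum_abs _ _)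
    _ ≤ _ := by
      simp only [Finset.mul_sum]
      refine Finset.sum_le_sum fun a _ => Finset.sum_le_sum fun b _ => ?_
      rw [abs_mul, abs_mul]
      have h3 : |V a b| * |y b| ≤ |y b| := mul_le_of_le_one_left (abs_nonneg _) (hV a b)
      have h4 := mul_le_mul_of_nonneg_left h3 (abs_nonneg (x a))
      have h5 := abs_mul_abs_self (x a)
      have h6 := abs_mul_abs_self (y b)
      nlinarith [sq_nonneg (|x a| - |y b|)]

lemma Hyp.iter_P (H : Hyp Pr piv Sg Q R) (h : stab Pr (Gam A B K)) (hα : cost Pr A B Q R piv Sg K ≤ α) (t : ℕ) (i x) :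
    bf ((opL Pr (Gam A B K))^[t] (PK Pr A B Q R K) i) x x ≤
      (1 - lamMin Q / (α / mu piv Sg)) ^ t * bf (PK Pr A B Q R K i) x x := by
  have hl := H.lQ_le h hα
  have a0 : 0 < α / mu piv Sg := H.lQ.trans_le hl
  set q := 1 - lamMin Q / (α / mu piv Sg) with hq
  have q0 : 0 ≤ q := by rw [hq, sub_nonneg, div_le_one a0]; exact hl
  have one : ∀ i x, bf (opL Pr (Gam A B K) (PK Pr A B Q R K) i) x x ≤ q * bf (PK Pr A B Q R K i) x x := by
    intro i x
    have h1 := bf_P (Q := Q) (R := R) h i x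
    have h2 := H.P_bound h hα i x
    have h3 := lamMin_bf H.hQ i x
    have h4 := psd_bf (H.hR i).posSemidef (K i *ᵥ x)
    rw [bf_opL]
    have h5 : lamMin Q / (α / mu piv Sg) * bf (PK Pr A B Q R K i) x x ≤ lamMin Q * (x ⬝ᵥ x) := by
      rw [div_mul_eq_mul_div, div_le_iff₀ a0, mul_assoc]
      refine mul_le_mul_of_nonneg_left ?_ H.lQ.le
      linarith
    rw [hq, sub_mul, one_mul]
    linarith
  induction t generalizing i x with
  | zero => simp
  | succ t ih =>
    rw [Function.iterate_succ_apply', bf_opL, bf_opE]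
    calc _ ≤ ∑ j, Pr i j * (q ^ t * bf (PK Pr A B Q R K j) (Gam A B K i *ᵥ x) (Gam A B K i *ᵥ x)) :=
          Finset.sum_le_sum fun j _ => mul_le_mul_of_nonneg_left (ih j _) (H.hPr i j)
      _ = q ^ t * bf (opL Pr (Gam A B K) (PK Pr A B Q R K) i) x x := by
          rw [bf_opL, bf_opE, Finset.mul_sum]
          exact Finset.sum_congr rfl fun j _ => by ring
      _ ≤ q ^ t * (q * bf (PK Pr A B Q R K i) x x) := mul_le_mul_of_nonneg_left (one i x) (pow_nonneg q0 t)
      _ = _ := by ring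

lemma opL_iter_smul (c : ℝ) (V) (t : ℕ) : (opL Pr Γ)^[t] (c • V) = c • (opL Pr Γ)^[t] V := by
  induction t with
  | zero => rfl
  | succ t ih => rw [Function.iterate_succ_apply', Function.iterate_succ_apply', ih, opL_smul]

lemma Hyp.row (H : Hyp Pr piv Sg Q R) (h : stab Pr (Gam A B K)) (hα : cost Pr A B Q R piv Sg K ≤ α) (t : ℕ) (p) :
    ∑ q, |(calA Pr (Gam A B K) ^ t) p q| ≤
      d / lamMin Q * (α / mu piv Sg) * (1 - lamMin Q / (α / mu piv Sg)) ^ t := by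
  have hl := H.lQ_le h hα
  have a0 : 0 < α / mu piv Sg := H.lQ.trans_le hl
  have q0 : 0 ≤ 1 - lamMin Q / (α / mu piv Sg) := by rw [sub_nonneg, div_le_one a0]; exact hl
  set V : Fin N → Matrix (Fin d) (Fin d) ℝ := fun j => Matrix.of fun c e =>
    ((SignType.sign ((calA Pr (Gam A B K) ^ t) p (j, c, e)) : SignType) : ℝ) with hV
  have h1 : ∑ q, |(calA Pr (Gam A B K) ^ t) p q| = (opL Pr (Gam A B K))^[t] V p.1 p.2.1 p.2.2 := by
    have := congrFun (calA_pow_mulVec Pr (Gam A B K) V t) p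
    rw [vecT] at this
    rw [← this, Matrix.mulVec, dotProduct]
    refine Finset.sum_congr rfl fun q _ => ?_
    exact (self_mul_sign _).symm
  have hV1 : ∀ j a b, |V j a b| ≤ 1 := by
    intro j a b
    simp only [hV, Matrix.of_apply]
    rcases SignType.trichotomy (SignType.sign ((calA Pr (Gam A B K) ^ t) p (j, a, b))) with h | h | h <;> rw [h] <;> simp
  have hdom : dom V ((d / lamMin Q) • PK Pr A B Q R K) := by
    intro j x y
    refine (bf_entry_bound (hV1 j) x y).trans ?_
    rw [Pi.smul_apply, bf_smul, bf_smul, ← mul_add, div_mul_eq_mul_div, le_div_iff₀ H.lQ, mul_assoc]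
    refine mul_le_mul_of_nonneg_left ?_ (Nat.cast_nonneg d)
    have aux : ∀ x, lamMin Q * (x ⬝ᵥ x) ≤ bf (PK Pr A B Q R K j) x x := by
      intro x
      have h2 := lamMin_bf H.hQ j x
      have h3 := bf_P (Q := Q) (R := R) h j x
      have h4 := psd_bf (H.hR j).posSemidef (K j *ᵥ x)
      have h5 := opE_nn H.hPr (H.P_nn h) j (Gam A B K j *ᵥ x)
      linarith
    linarith [aux x, aux y]
  obtain ⟨i, a, b⟩ := p
  have h2 := hdom.iter (Γ := Gam A B K) H.hPr t i (Pi.single a 1) (Pi.single b 1)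
  rw [opL_iter_smul, Pi.smul_apply, bf_smul, bf_smul] at h2
  have h3 : bf ((opL Pr (Gam A B K))^[t] V i) (Pi.single a 1) (Pi.single b 1) = (opL Pr (Gam A B K))^[t] V i a b := by
    simp [bf]
  have h4 : ∀ c : Fin d, bf ((opL Pr (Gam A B K))^[t] (PK Pr A B Q R K) i) (Pi.single c 1) (Pi.single c 1)
      ≤ (1 - lamMin Q / (α / mu piv Sg)) ^ t * (α / mu piv Sg) := by
    intro c
    refine (H.iter_P h hα t i _).trans (mul_le_mul_of_nonneg_left ?_ (pow_nonneg q0 t))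
    refine (H.P_bound h hα i _).trans (le_of_eq ?_)
    simp
  rw [h3] at h2
  rw [h1]
  have h5 : 0 ≤ (d : ℝ) / lamMin Q := div_nonneg (Nat.cast_nonneg d) H.lQ.le
  have h6 := mul_le_mul_of_nonneg_left (h4 a) h5
  have h7 := mul_le_mul_of_nonneg_left (h4 b) h5
  have h8 := le_abs_self ((opL Pr (Gam A B K))^[t] V i a b)
  linarith

lemma Hyp.closed (H : Hyp Pr piv Sg Q R) (h : stab Pr (Gam A B K)) (hα : cost Pr A B Q R piv Sg K ≤ α) (D) :
    IsClosed {r : ℝ | stab Pr (Gam A B (K + r • D)) ∧ cost Pr A B Q R piv Sg (K + r • D) ≤ α} := by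
  have hl := H.lQ_le h hα
  have a0 : 0 < α / mu piv Sg := H.lQ.trans_le hl
  have q0 : 0 ≤ 1 - lamMin Q / (α / mu piv Sg) := by rw [sub_nonneg, div_le_one a0]; exact hl
  have q1 : 1 - lamMin Q / (α / mu piv Sg) < 1 := by
    have := div_pos H.lQ a0; linarith
  have ht : Tendsto (fun t : ℕ => d / lamMin Q * (α / mu piv Sg) * (1 - lamMin Q / (α / mu piv Sg)) ^ t) atTop (𝓝 0) := by
    have := (tendsto_pow_atTop_nhds_zero_of_lt_one q0 q1).const_mul (d / lamMin Q * (α / mu piv Sg))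
    simpa using this
  obtain ⟨t, ht⟩ := (ht.eventually_le_const (show (0:ℝ) < 1 / 2 by norm_num)).exists
  have : Nonempty (Fin N × Fin d × Fin d) := ⟨(⟨0, H.hN⟩, ⟨0, H.hd⟩, ⟨0, H.hd⟩)⟩
  set F : Set ℝ := {r | ∀ p, ∑ q, |(calA Pr (Gam A B (K + r • D)) ^ t) p q| ≤ 1 / 2} with hF
  have hFc : IsClosed F := by
    rw [hF, Set.ofPred_forall]
    refine isClosed_iInter fun p => isClosed_le ?_ continuous_const
    exact continuous_finsetSum _ fun q _ => (continuous_calA_pow Pr A B t p q K D).abs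
  have hFs : ∀ r ∈ F, stab Pr (Gam A B (K + r • D)) := fun r hr =>
    sr_of_row _ t fun p => lt_of_le_of_lt (hr p) (by norm_num)
  have heq : {r : ℝ | stab Pr (Gam A B (K + r • D)) ∧ cost Pr A B Q R piv Sg (K + r • D) ≤ α} =
      F ∩ (fun r : ℝ => cost Pr A B Q R piv Sg (K + r • D)) ⁻¹' Set.Iic α := by
    ext r
    constructor
    · rintro ⟨h1, h2⟩
      exact ⟨fun p => (H.row h1 h2 t p).trans ht, h2⟩
    · rintro ⟨h1, h2⟩
      exact ⟨hFs r h1, h2⟩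
  rw [heq]
  refine ContinuousOn.preimage_isClosed_of_isClosed ?_ hFc isClosed_Iic
  obtain ⟨p', p'', hp⟩ := line_deriv Pr A B Q R H.hd H.hN K D
  intro r hr
  exact (mHD.fc piv Sg (hp r (hFs r hr)).2.2.1).continuousAt.continuousWithinAt

end main

/-- abstract descent lemma along a line -/
lemma descent {φ φ' φ'' : ℝ → ℝ} {S : Set ℝ} {α g L η : ℝ} (hS : IsClosed S) (h0 : (0:ℝ) ∈ S)
    (h1 : ∀ s ∈ S, HasDerivAt φ (φ' s) s) (h2 : ∀ s ∈ S, HasDerivAt φ' (φ'' s) s)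
    (h3 : ∀ s ∈ S, φ'' s ≤ L * g) (hg : 0 < g) (hφ0 : φ' 0 = - g) (hη : 0 < η) (hL : η * L ≤ 1)
    (hα : ∀ s ∈ S, φ s ≤ α) (hop : ∀ s ∈ S, ∀ᶠ r in 𝓝 s, φ r ≤ α → r ∈ S) :
    η ∈ S ∧ φ η ≤ φ 0 - η / 2 * g := by
  have dec1 : ∀ s, 0 ≤ s → Set.Icc 0 s ⊆ S → φ' s ≤ - g + L * g * s := by
    intro s hs hsub
    have := image_le_of_deriv_right_le_deriv_boundary (f := φ') (f' := φ'') (a := 0) (b := s)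
      (B := fun s => - g + L * g * s) (B' := fun _ => L * g)
      (fun x hx => (h2 x (hsub hx)).continuousAt.continuousWithinAt)
      (fun x hx => (h2 x (hsub (Set.Ico_subset_Icc_self hx))).hasDerivWithinAt)
      (by rw [hφ0]; simp)
      (by fun_prop)
      (fun x _ => by
        have := ((hasDerivAt_id x).const_mul (L * g)).const_add (-g)
        simpa using this.hasDerivWithinAt)
      (fun x hx => h3 x (hsub (Set.Ico_subset_Icc_self hx)))
    exact this (Set.right_mem_Icc.2 hs)
  have hsub : Set.Icc 0 η ⊆ {s | Set.Icc 0 s ⊆ S} := by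
    refine IsClosed.Icc_subset_of_forall_exists_gt (a := 0) (b := η) ?_ ?_ ?_
    · have : {s | Set.Icc 0 s ⊆ S} ∩ Set.Icc 0 η = (⋂ x ∈ Set.Ioc 0 η \ S, Set.Iic x) ∩ Set.Icc 0 η := by
        ext s
        simp only [Set.mem_inter_iff, Set.mem_ofPred_eq, Set.mem_iInter, Set.mem_Iic, and_congr_left_iff]
        rintro ⟨hs0, hs1⟩
        constructor
        · intro h x hx
          by_contra hlt
          exact hx.2 (h ⟨hx.1.1.le, (not_le.1 hlt).le⟩)
        · intro h x hx
          rcases hx.2.lt_or_eq with hlt | heq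
          · by_contra hxS
            rcases hx.1.eq_or_lt with h | hpos
            · exact hxS (h ▸ h0)
            · exact absurd (h x ⟨⟨hpos, hx.2.trans hs1⟩, hxS⟩) (not_le.2 hlt)
          · rcases hs0.eq_or_lt with h' | hpos
            · rw [heq, ← h']; exact h0
            · have hcl : Set.Ico 0 s ⊆ S := by
                intro y hy
                by_contra hyS
                rcases hy.1.eq_or_lt with h | hpos
                · exact hyS (h ▸ h0)
                · exact absurd (h y ⟨⟨hpos, hy.2.le.trans hs1⟩, hyS⟩) (not_le.2 hy.2)
              have := hS.closure_subset_iff.2 hcl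
              rw [closure_Ico hpos.ne] at this
              exact this hx
      rw [this]
      exact (isClosed_biInter fun x _ => isClosed_Iic).inter isClosed_Icc
    · simp only [Set.mem_ofPred_eq, Set.Icc_self, Set.singleton_subset_iff]; exact h0
    · rintro s ⟨hs, hs0, hsη⟩ y hy
      have hsS : s ∈ S := hs (Set.right_mem_Icc.2 hs0)
      have hneg : φ' s < 0 := by
        have h4 := dec1 s hs0 hs
        have h5 : L * s < 1 := by
          rcases le_or_gt L 0 with hL0 | hL0
          · nlinarith
          · nlinarith
        nlinarith
      have hev : ∀ᶠ r in 𝓝[>] s, φ r < φ s := by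
        have h5 := (hasDerivWithinAt_iff_tendsto_slope' (s := Set.Ioi s) (by simp)).1 ((h1 s hsS).hasDerivWithinAt)
        filter_upwards [h5.eventually_lt_const hneg, self_mem_nhdsWithin] with r hr hr'
        rw [slope_def_field, div_neg_iff] at hr
        have : 0 < r - s := sub_pos.2 hr'
        rcases hr with hr | hr
        · linarith
        · linarith
      have hev2 : ∀ᶠ r in 𝓝[>] s, r ∈ S := by
        filter_upwards [hev, (hop s hsS).filter_mono nhdsWithin_le_nhds] with r h6 h7
        exact h7 (h6.le.trans (hα s hsS))
      obtain ⟨u, hu, hu2⟩ := (mem_nhdsGT_iff_exists_Ioc_subset).1 hev2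
      refine ⟨min u y, ?_, lt_min hu hy, min_le_right _ _⟩
      intro x hx
      rcases le_or_gt x s with hxs | hxs
      · exact hs ⟨hx.1, hxs⟩
      · exact hu2 ⟨hxs, hx.2.trans (min_le_left _ _)⟩
  have hI : Set.Icc 0 η ⊆ S := hsub (Set.right_mem_Icc.2 hη.le)
  refine ⟨hI (Set.right_mem_Icc.2 hη.le), ?_⟩
  have := image_le_of_deriv_right_le_deriv_boundary (f := φ) (f' := φ') (a := 0) (b := η)
      (B := fun s => φ 0 + (- g * s + L * g / 2 * s ^ 2)) (B' := fun s => - g + L * g * s)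
      (fun x hx => (h1 x (hI hx)).continuousAt.continuousWithinAt)
      (fun x hx => (h1 x (hI (Set.Ico_subset_Icc_self hx))).hasDerivWithinAt)
      (by simp)
      (by fun_prop)
      (fun x _ => by
        have := (((hasDerivAt_id x).const_mul (-g)).add (((hasDerivAt_id x).pow 2).const_mul (L * g / 2))).const_add (φ 0)
        refine (this.congr_deriv ?_).hasDerivWithinAt
        simp; ring)
      (fun x hx => dec1 x hx.1 fun y hy => hI ⟨hy.1, hy.2.trans hx.2.le⟩)
  have h9 := this (Set.right_mem_Icc.2 hη.le)
  have h10 : η * L * (η * g) ≤ 1 * (η * g) := mul_le_mul_of_nonneg_right hL (by positivity)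
  nlinarith

section ipl
variable {a b N : ℕ} (V S : Fin N → Matrix (Fin a) (Fin b) ℝ)
lemma ip_self_nonneg : 0 ≤ ip V V := Finset.sum_nonneg fun i _ => ip_term_nonneg (V i)
lemma ip_comm : ip V S = ip S V := by
  refine Finset.sum_congr rfl fun i _ => ?_
  rw [← Matrix.trace_transpose, Matrix.transpose_mul, Matrix.transpose_transpose]
lemma ip_neg_right : ip V (-S) = - ip V S := by simp [ip]
lemma ip_neg_neg : ip (-V) (-V) = ip V V := by simp [ip]
lemma ip_expand (c : ℝ) : ip (V - c • S) (V - c • S) = ip V V - 2 * c * ip V S + c ^ 2 * ip S S := by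
  have h1 : ip (V - c • S) (V - c • S) = ip V V - c * ip V S - c * ip S V + c ^ 2 * ip S S := by
    simp only [ip, Finset.mul_sum, ← Finset.sum_sub_distrib, ← Finset.sum_add_distrib]
    refine Finset.sum_congr rfl fun i _ => ?_
    simp only [Pi.sub_apply, Pi.smul_apply, Matrix.transpose_sub, Matrix.transpose_smul, Matrix.sub_mul, Matrix.mul_sub,
      Matrix.smul_mul, Matrix.mul_smul, Matrix.trace_sub, Matrix.trace_smul, smul_eq_mul]
    ring
  rw [h1, ip_comm S V]; ring
lemma eq_zero_of_ip (h : ip V V = 0) : V = 0 := by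
  have h1 := (Finset.sum_eq_zero_iff_of_nonneg (fun i _ => ip_term_nonneg (V i))).1 h
  funext i
  have := h1 i (Finset.mem_univ i)
  rw [← Matrix.conjTranspose_eq_transpose_of_trivial] at this
  exact Matrix.trace_conjTranspose_mul_self_eq_zero_iff.1 this
end ipl

section main
variable {d k N : ℕ} {Pr : Matrix (Fin N) (Fin N) ℝ} {piv : Fin N → ℝ} {Sg : Matrix (Fin d) (Fin d) ℝ}
  {Q : Fin N → Matrix (Fin d) (Fin d) ℝ} {R : Fin N → Matrix (Fin k) (Fin k) ℝ}
  {A : Fin N → Matrix (Fin d) (Fin d) ℝ} {B : Fin N → Matrix (Fin d) (Fin k) ℝ}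
  {K D Ks G : Fin N → Matrix (Fin k) (Fin d) ℝ} {Γ : Fin N → Matrix (Fin d) (Fin d) ℝ} {α η : ℝ}

/-- `opT` as a linear map -/
def opTlin (Pr : Matrix (Fin N) (Fin N) ℝ) (Γ : Fin N → Matrix (Fin d) (Fin d) ℝ) :
    (Fin N → Matrix (Fin d) (Fin d) ℝ) →ₗ[ℝ] (Fin N → Matrix (Fin d) (Fin d) ℝ) where
  toFun := opT Pr Γ
  map_add' V W := by
    funext j; simp [opT, Matrix.mul_add, Matrix.add_mul, Finset.sum_add_distrib]
  map_smul' c V := by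
    funext j
    simp [opT, Finset.smul_sum, smul_comm c]

lemma continuous_opT : Continuous (opTlin Pr Γ) := by
  change Continuous (opT Pr Γ)
  unfold opT
  fun_prop

lemma XK_fix (h : stab Pr Γ) :
    XK Pr piv Sg Γ = (fun i => piv i • Sg) + opT Pr Γ (XK Pr piv Sg Γ) := by
  have hs := h.summable (fun i => piv i • Sg)
  have h1 := hs.map_tsum (opTlin Pr Γ) continuous_opT
  have h2 : opT Pr Γ (XK Pr piv Sg Γ) = ∑' t : ℕ, (opT Pr Γ)^[t + 1] (fun i => piv i • Sg) := by
    refine Eq.trans h1 ?_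
    refine tsum_congr fun t => ?_
    rw [Function.iterate_succ_apply']; rfl
  rw [h2]
  exact hs.tsum_eq_zero_add

lemma adj (X V : Fin N → Matrix (Fin d) (Fin d) ℝ) :
    ∑ i, (X i * opL Pr Γ V i).trace = ∑ i, (opT Pr Γ X i * V i).trace := by
  have h1 : ∀ i, (X i * opL Pr Γ V i).trace = ∑ j, Pr i j * (Γ i * X i * (Γ i)ᵀ * V j).trace := by
    intro i
    simp only [opL, opE, Matrix.mul_sum, Matrix.sum_mul, Matrix.trace_sum, Matrix.mul_smul, Matrix.smul_mul,
      Matrix.trace_smul, smul_eq_mul]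
    refine Finset.sum_congr rfl fun j _ => ?_
    congr 1
    rw [← Matrix.mul_assoc, Matrix.trace_mul_comm]
    simp only [Matrix.mul_assoc]
  have h2 : ∀ j, (opT Pr Γ X j * V j).trace = ∑ i, Pr i j * (Γ i * X i * (Γ i)ᵀ * V j).trace := by
    intro j
    simp only [opT, Matrix.sum_mul, Matrix.trace_sum, Matrix.smul_mul, Matrix.trace_smul, smul_eq_mul]
  simp only [h1, h2]
  exact Finset.sum_comm

lemma J_eq_X (h : stab Pr Γ) (V : Fin N → Matrix (Fin d) (Fin d) ℝ) :
    J Pr piv Sg Γ V = ∑ i, (XK Pr piv Sg Γ i * V i).trace := by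
  set U := sol Pr Γ V with hU
  set X := XK Pr piv Sg Γ with hX
  have hV : V = U - opL Pr Γ U := by
    rw [eq_sub_iff_add_eq]; exact (sol_eq h.isUnit V).symm
  have h0 : J Pr piv Sg Γ V = ∑ i, ((piv i • Sg) * U i).trace := by
    change fc piv Sg U = _
    refine Finset.sum_congr rfl fun i _ => ?_
    rw [Matrix.smul_mul, Matrix.trace_smul, Matrix.trace_mul_comm, smul_eq_mul]
  have h1 : ∑ i, (X i * V i).trace = ∑ i, (X i * U i).trace - ∑ i, (X i * opL Pr Γ U i).trace := by
    rw [← Finset.sum_sub_distrib]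
    refine Finset.sum_congr rfl fun i _ => ?_
    conv_lhs => rw [hV]
    rw [Pi.sub_apply, Matrix.mul_sub, Matrix.trace_sub]
  have h2 : ∑ i, (X i * U i).trace = ∑ i, ((piv i • Sg) * U i).trace + ∑ i, (opT Pr Γ X i * U i).trace := by
    rw [← Finset.sum_add_distrib]
    refine Finset.sum_congr rfl fun i _ => ?_
    have := congrFun (XK_fix (piv := piv) (Sg := Sg) h) i
    rw [← hX] at this
    conv_lhs => rw [this]
    rw [Pi.add_apply, Matrix.add_mul, Matrix.trace_add]
  rw [h0, h1, adj, h2]; ring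

lemma J_LL (h : stab Pr Γ) (L : Fin N → Matrix (Fin k) (Fin d) ℝ) :
    J Pr piv Sg Γ (fun i => (L i)ᵀ * L i) ≤ maxNorm (XK Pr piv Sg Γ) * ip L L := by
  rw [J_eq_X h, ip, Finset.mul_sum]
  refine Finset.sum_le_sum fun i _ => ?_
  have h1 := trace_tmul_bf (L i) 1
  rw [one_mul] at h1
  rw [trace_tmul_bf, h1, Finset.mul_sum]
  refine Finset.sum_le_sum fun r _ => ?_
  rw [bf_one]
  exact maxNorm_bf _ i _

lemma Hyp.Zs_eq (H : Hyp Pr piv Sg Q R) (h : stab Pr (Gam A B K)) (i) :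
    Zs Pr A B R K D (PK Pr A B Q R K) i = (D i)ᵀ * LK Pr A B Q R K i + (LK Pr A B Q R K i)ᵀ * D i := by
  have hr : (R i)ᵀ = R i := by simpa using (H.hR i).isHermitian.eq
  have hE : (opE Pr (PK Pr A B Q R K) i)ᵀ = opE Pr (PK Pr A B Q R K) i := E_symm (H.P_symm h) i
  simp only [Zs, LK, Gam, Matrix.transpose_sub, Matrix.transpose_add, Matrix.transpose_mul, Matrix.transpose_transpose, hr, hE,
    Matrix.mul_sub, Matrix.sub_mul, Matrix.add_mul, Matrix.mul_add, Matrix.mul_assoc]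
  abel

lemma Hyp.gap (H : Hyp Pr piv Sg Q R) (h : stab Pr (Gam A B K)) (hs : stab Pr (Gam A B Ks)) :
    lamMin R * (cost Pr A B Q R piv Sg K - cost Pr A B Q R piv Sg Ks) ≤
      maxNorm (XK Pr piv Sg (Gam A B Ks)) * ip (LK Pr A B Q R K) (LK Pr A B Q R K) := by
  set P := PK Pr A B Q R K with hP
  set Ps := PK Pr A B Q R Ks with hPs
  set L := LK Pr A B Q R K with hL
  set S := src Q R Ks - src Q R K + opL Pr (Gam A B Ks) P - opL Pr (Gam A B K) P with hS
  have hfix : Ps - P = S + opL Pr (Gam A B Ks) (Ps - P) := by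
    have h1 := PK_fix Pr A B Q R h
    have h2 := PK_fix Pr A B Q R hs
    rw [← hP] at h1
    rw [← hPs] at h2
    rw [opL_sub, hS]
    conv_lhs => rw [h1, h2]
    abel
  have h1 : J Pr piv Sg (Gam A B Ks) S = cost Pr A B Q R piv Sg Ks - cost Pr A B Q R piv Sg K := by
    rw [J_fix hs hfix, fc_sub]; rfl
  have h2 : J Pr piv Sg (Gam A B Ks) (-(lamMin R • S)) ≤ J Pr piv Sg (Gam A B Ks) (fun i => (L i)ᵀ * L i) := by
    refine H.J_mono hs fun i x => ?_
    have hZ : bf (Zs Pr A B R K (Ks - K) P i) x x = 2 * (((Ks - K) i *ᵥ x) ⬝ᵥ (L i *ᵥ x)) := by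
      rw [hP, H.Zs_eq h, bf_add, bf_mul, bf_mul, bf_t, bf_t, dotProduct_comm (L i *ᵥ x)]; ring
    rw [bf_Zs] at hZ
    have hk1 : Ks i *ᵥ x = K i *ᵥ x + (Ks - K) i *ᵥ x := by
      rw [← Matrix.add_mulVec]; simp
    have hg1 : Gam A B Ks i *ᵥ x = Gam A B K i *ᵥ x - (B i * (Ks - K) i) *ᵥ x := by
      rw [← Matrix.sub_mulVec]; congr 1
      simp only [Gam, Pi.sub_apply, Matrix.mul_sub]; abel
    have hSb : bf (S i) x x = 2 * (((Ks - K) i *ᵥ x) ⬝ᵥ (L i *ᵥ x)) + bf (R i) ((Ks - K) i *ᵥ x) ((Ks - K) i *ᵥ x)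
        + bf (opE Pr P i) ((B i * (Ks - K) i) *ᵥ x) ((B i * (Ks - K) i) *ᵥ x) := by
      rw [← hZ, hS]
      simp only [Pi.sub_apply, Pi.add_apply, bf_sub, bf_add, src, bf_opL, bf_sand]
      rw [hk1, hg1]
      simp only [bf_add_left, bf_add_right, bf_sub_left, bf_sub_right, Pi.sub_apply]
      ring
    have hEn : 0 ≤ bf (opE Pr P i) ((B i * (Ks - K) i) *ᵥ x) ((B i * (Ks - K) i) *ᵥ x) := opE_nn H.hPr (H.P_nn h) i _
    have hRn := lamMin_bf H.hR i ((Ks - K) i *ᵥ x)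
    rw [Pi.neg_apply, Pi.smul_apply, bf_neg, bf_smul, bf_mul, bf_t, hSb]
    have hsq := dot_self_nonneg (lamMin R • ((Ks - K) i *ᵥ x) + L i *ᵥ x)
    simp only [add_dotProduct, dotProduct_add, smul_dotProduct, dotProduct_smul, smul_eq_mul] at hsq
    rw [dotProduct_comm (L i *ᵥ x) ((Ks - K) i *ᵥ x)] at hsq
    have h3 := mul_le_mul_of_nonneg_left hRn H.lR.le
    have h4 := mul_nonneg H.lR.le hEn
    nlinarith
  rw [map_neg, map_smul, h1, smul_eq_mul] at h2
  have h3 := J_LL (piv := piv) (Sg := Sg) hs L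
  linarith

section Normed
attribute [local instance] Matrix.normedAddCommGroup Matrix.normedSpace

lemma Hyp.grad_ge (H : Hyp Pr piv Sg Q R) (h : stab Pr (Gam A B K))
    (hG : ∀ E, fderiv ℝ (cost Pr A B Q R piv Sg) K E = ip G E) :
    4 * mu piv Sg ^ 2 * ip (LK Pr A B Q R K) (LK Pr A B Q R K) ≤ ip G G := by
  set L := LK Pr A B Q R K with hL
  obtain ⟨p', p'', hp⟩ := line_deriv Pr A B Q R H.hd H.hN K L
  have h0 : stab Pr (Gam A B (K + (0:ℝ) • L)) := by simpa using h
  obtain ⟨e1, -, e3, -⟩ := hp 0 h0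
  have h1 := cost_fderiv Pr A B Q R piv Sg K L h _ (mHD.fc piv Sg e3)
  rw [zero_smul, add_zero] at e1
  rw [hG, ← J_fix h e1] at h1
  have hZ : Zs Pr A B R K L (PK Pr A B Q R K) = (2:ℝ) • fun i => (L i)ᵀ * L i := by
    funext i
    rw [H.Zs_eq h, Pi.smul_apply, two_smul]
  have hn : nn (fun i => (L i)ᵀ * L i) := fun i x => by
    rw [bf_mul, bf_t]; exact dot_self_nonneg _
  rw [hZ, map_smul, smul_eq_mul] at h1
  have h2 := H.fc_le_J h hn
  have h3 := H.fc_mu hn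
  have h4 := ip_self_nonneg (G - (2 * mu piv Sg) • L)
  rw [ip_expand, h1] at h4
  have h5 : mu piv Sg * ip L L ≤ fc piv Sg fun i => (L i)ᵀ * L i := h3
  have h6 := mul_le_mul_of_nonneg_left (h5.trans h2) H.mu_pos.le
  nlinarith

lemma Hyp.PL (H : Hyp Pr piv Sg Q R) (h : stab Pr (Gam A B K)) (hs : stab Pr (Gam A B Ks))
    (hG : ∀ E, fderiv ℝ (cost Pr A B Q R piv Sg) K E = ip G E) :
    4 * mu piv Sg ^ 2 * lamMin R * (cost Pr A B Q R piv Sg K - cost Pr A B Q R piv Sg Ks) ≤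
      maxNorm (XK Pr piv Sg (Gam A B Ks)) * ip G G := by
  have h1 := H.gap h hs
  have h2 := H.grad_ge h hG
  have h3 := mul_le_mul_of_nonneg_left h2 (maxNorm_nonneg (XK Pr piv Sg (Gam A B Ks)))
  have h4 := mul_le_mul_of_nonneg_left h1 (show 0 ≤ 4 * mu piv Sg ^ 2 by positivity)
  linarith

lemma Hyp.step (H : Hyp Pr piv Sg Q R) (h : stab Pr (Gam A B K)) (hα : cost Pr A B Q R piv Sg K ≤ α)
    (hη0 : 0 < η) (hη : η ≤ 1 / Lsm B R Q piv Sg α)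
    (hG : ∀ E, fderiv ℝ (cost Pr A B Q R piv Sg) K E = ip G E) :
    stab Pr (Gam A B (K - η • G)) ∧
      cost Pr A B Q R piv Sg (K - η • G) ≤ cost Pr A B Q R piv Sg K - η / 2 * ip G G := by
  rcases (ip_self_nonneg G).eq_or_lt with hg | hg
  · rw [eq_zero_of_ip G hg.symm]
    simpa [ip] using h
  · obtain ⟨p', p'', hp⟩ := line_deriv Pr A B Q R H.hd H.hN K (-G)
    have hLpos : 0 < Lsm B R Q piv Sg α := by
      by_contra hcon
      have : 1 / Lsm B R Q piv Sg α ≤ 0 := one_div_nonpos.2 (not_lt.1 hcon)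
      linarith
    have h0 : stab Pr (Gam A B (K + (0:ℝ) • (-G))) := by simpa using h
    have hfd : fc piv Sg (p' 0) = - ip G G := by
      have h1 := cost_fderiv Pr A B Q R piv Sg K (-G) h _ (mHD.fc piv Sg (hp 0 h0).2.2.1)
      rw [← h1, hG, ip_neg_right]
    have key := descent (φ := fun r => cost Pr A B Q R piv Sg (K + r • (-G)))
      (φ' := fun r => fc piv Sg (p' r)) (φ'' := fun r => fc piv Sg (p'' r))
      (α := α) (g := ip G G) (L := Lsm B R Q piv Sg α) (η := η) (H.closed h hα (-G))
      ⟨h0, by simpa using hα⟩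
      (fun s hs => mHD.fc piv Sg (hp s hs.1).2.2.1)
      (fun s hs => mHD.fc piv Sg (hp s hs.1).2.2.2)
      (fun s hs => by
        have := H.smooth (D := -G) hs.1 hs.2 (by rw [ip_neg_neg]; exact hg) (hp s hs.1).1 (hp s hs.1).2.1
        rwa [ip_neg_neg] at this)
      hg hfd hη0 ((le_div_iff₀ hLpos).1 hη) (fun s hs => hs.2)
      (fun s hs => by
        filter_upwards [stab_eventually Pr A B H.hd H.hN K (-G) s hs.1] with r hr hr2
        exact ⟨hr, hr2⟩)
    have e : K + η • (-G) = K - η • G := by rw [smul_neg, sub_eq_add_neg]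
    obtain ⟨⟨k1, -⟩, k2⟩ := key
    simp only [zero_smul, add_zero] at k2
    rw [e] at k1 k2
    exact ⟨k1, k2⟩

end Normed
end main

lemma geom_aux {e : ℕ → ℝ} {c : ℝ} (h0 : ∀ n, 0 ≤ e n) (h : ∀ n, e (n + 1) ≤ (1 - c) * e n) (n : ℕ) :
    e n ≤ (1 - c) ^ n * e 0 := by
  rcases le_or_gt 0 (1 - c) with hc | hc
  · induction n with
    | zero => simp
    | succ n ih =>
      calc e (n + 1) ≤ (1 - c) * e n := h n
        _ ≤ (1 - c) * ((1 - c) ^ n * e 0) := mul_le_mul_of_nonneg_left ih hc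
        _ = _ := by ring
  · have hz : ∀ n, e n = 0 := by
      intro n
      refine le_antisymm ?_ (h0 n)
      by_contra hcon
      have := mul_neg_of_neg_of_pos hc (not_le.1 hcon)
      linarith [h n, h0 (n + 1)]
    rw [hz n, hz 0, mul_zero]


attribute [local instance] Matrix.normedAddCommGroup Matrix.normedSpace

/-- global linear convergence of gradient descent. -/
theorem gd_global_linear_convergence
    (d k N : ℕ) (hd : 0 < d) (hk : 0 < k) (hN : 0 < N)
    (A : Fin N → Matrix (Fin d) (Fin d) ℝ) (B : Fin N → Matrix (Fin d) (Fin k) ℝ)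
    (Pr : Matrix (Fin N) (Fin N) ℝ)
    (hPr : ∀ i j, 0 ≤ Pr i j) (hPrSum : ∀ i, ∑ j, Pr i j = 1)
    (piv : Fin N → ℝ) (hpiv : ∀ i, 0 < piv i) (hpivSum : ∑ i, piv i = 1)
    (Sg : Matrix (Fin d) (Fin d) ℝ) (hSg : Sg.PosDef)
    (Q : Fin N → Matrix (Fin d) (Fin d) ℝ) (hQ : ∀ i, (Q i).PosDef)
    (R : Fin N → Matrix (Fin k) (Fin k) ℝ) (hR : ∀ i, (R i).PosDef)
    (K0 : Fin N → Matrix (Fin k) (Fin d) ℝ) (hK0 : MSS Pr A B K0)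
    (η : ℝ) (hη0 : 0 < η) (hη : η ≤ 1 / Lsm B R Q piv Sg (cost Pr A B Q R piv Sg K0))
    (Ks : Fin N → Matrix (Fin k) (Fin d) ℝ) (hKs : MSS Pr A B Ks)
    (hopt : ∀ K' : Fin N → Matrix (Fin k) (Fin d) ℝ, MSS Pr A B K' → cost Pr A B Q R piv Sg Ks ≤ cost Pr A B Q R piv Sg K')
    (Kseq : ℕ → Fin N → Matrix (Fin k) (Fin d) ℝ) (hinit : Kseq 0 = K0)
    (G : ℕ → Fin N → Matrix (Fin k) (Fin d) ℝ)
    (hG : ∀ n, ∀ E : Fin N → Matrix (Fin k) (Fin d) ℝ, fderiv ℝ (cost Pr A B Q R piv Sg) (Kseq n) E = ip (G n) E)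
    (hstep : ∀ n, Kseq (n + 1) = Kseq n - η • G n) :
    ∀ n, MSS Pr A B (Kseq n) ∧
      cost Pr A B Q R piv Sg (Kseq n) - cost Pr A B Q R piv Sg Ks
        ≤ (1 - 2 * mu piv Sg ^ 2 * lamMin R * η
              / maxNorm (XK Pr piv Sg (Gam A B Ks))) ^ n
            * (cost Pr A B Q R piv Sg K0 - cost Pr A B Q R piv Sg Ks) := by
  have H : Hyp Pr piv Sg Q R := ⟨hd, hk, hN, hPr, hPrSum, hpiv, hSg, hQ, hR⟩
  have hs : stab Pr (Gam A B Ks) := (MSS_iff Pr A B Ks).1 hKs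
  set X := maxNorm (XK Pr piv Sg (Gam A B Ks)) with hX
  have inv : ∀ n, stab Pr (Gam A B (Kseq n)) ∧
      cost Pr A B Q R piv Sg (Kseq n) ≤ cost Pr A B Q R piv Sg K0 := by
    intro n
    induction n with
    | zero => rw [hinit]; exact ⟨(MSS_iff Pr A B K0).1 hK0, le_rfl⟩
    | succ n ih =>
      have h1 := H.step ih.1 ih.2 hη0 hη (hG n)
      rw [← hstep n] at h1
      have h2 := mul_nonneg (half_pos hη0).le (ip_self_nonneg (G n))
      exact ⟨h1.1, by linarith [h1.2, ih.2]⟩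
  have mss : ∀ n, MSS Pr A B (Kseq n) := fun n => (MSS_iff Pr A B _).2 (inv n).1
  have contr : ∀ n, cost Pr A B Q R piv Sg (Kseq (n + 1)) - cost Pr A B Q R piv Sg Ks ≤
      (1 - 2 * mu piv Sg ^ 2 * lamMin R * η / X) *
        (cost Pr A B Q R piv Sg (Kseq n) - cost Pr A B Q R piv Sg Ks) := by
    intro n
    have h1 := (H.step (inv n).1 (inv n).2 hη0 hη (hG n)).2
    rw [← hstep n] at h1
    have h2 := H.PL (inv n).1 hs (hG n)
    rw [← hX] at h2
    have h3 : 2 * mu piv Sg ^ 2 * lamMin R * η / X *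
        (cost Pr A B Q R piv Sg (Kseq n) - cost Pr A B Q R piv Sg Ks) ≤ η / 2 * ip (G n) (G n) := by
      have hX0 : 0 ≤ X := maxNorm_nonneg _
      rcases hX0.eq_or_lt with h0 | h0
      · rw [← h0, div_zero, zero_mul]
        exact mul_nonneg (half_pos hη0).le (ip_self_nonneg (G n))
      · rw [div_mul_eq_mul_div, div_le_iff₀ h0]
        have := mul_le_mul_of_nonneg_left h2 (half_pos hη0).le
        linarith
    linarith
  intro n
  refine ⟨mss n, ?_⟩
  have := geom_aux (e := fun n => cost Pr A B Q R piv Sg (Kseq n) - cost Pr A B Q R piv Sg Ks)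
    (fun n => sub_nonneg.2 (hopt _ (mss n))) contr n
  simpa only [hinit] using this

end MJLS
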